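/- arXiv:gr-qc/0204030 — 4 statements merged into one kernel-verified Lean document; each statement's English description precedes it below -/
import Mathlib

section
/- In a collapsing ARS model, if there exist x > α and r₁ ∈ (0,r₀] such that the curve r ↦ x r³ is a strict subsolution of the radial null geodesic equation on (0,r₁], i.e. 3 x r² < u(r,x r³) √Δ(r,x r³) (Y(r,x r³) − u(r,x r³)) for all r ∈ (0,r₁], then the central singularity is locally naked. -/
noncomputable section

open Real Set Filter Topology Asymptotics MeasureTheory intervalIntegral

/-- Data for an area-radius separable (ARS) spacetime: a size `r₀` of the comoving
coordinate range, generating functions `Ψ` (Misner–Sharp mass) and `Y`, the third-order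
Taylor coefficients `h30, h21, h12, h03` of `G(r,R) = 2Ψ(r,R) + R(Y(r,R)² − 1)` at the
origin, together with all the regularity and positivity requirements. -/
structure ARSData where
  r₀ : ℝ
  Ψ : ℝ → ℝ → ℝ
  Y : ℝ → ℝ → ℝ
  h30 : ℝ
  h21 : ℝ
  h12 : ℝ
  h03 : ℝ
  r₀_pos : 0 < r₀
  /-- `Ψ` and `Y` are `C^∞` on a neighborhood of `[0,r₀] × [0,r₀]`. -/
  smooth : ∃ U : Set (ℝ × ℝ), IsOpen U ∧ Icc 0 r₀ ×ˢ Icc 0 r₀ ⊆ U ∧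
      ContDiffOn ℝ (⊤ : ℕ∞) (fun p : ℝ × ℝ => Ψ p.1 p.2) U ∧
      ContDiffOn ℝ (⊤ : ℕ∞) (fun p : ℝ × ℝ => Y p.1 p.2) U
  Y_pos : ∀ r ∈ Icc (0:ℝ) r₀, ∀ R ∈ Icc (0:ℝ) r₀, 0 < Y r R
  Ψ_nonneg : ∀ r ∈ Icc (0:ℝ) r₀, ∀ R ∈ Icc (0:ℝ) r₀, 0 ≤ Ψ r R
  Ψr_nonneg : ∀ r ∈ Icc (0:ℝ) r₀, ∀ R ∈ Icc (0:ℝ) r₀, 0 ≤ deriv (fun s => Ψ s R) r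
  ΨR_nonneg : ∀ r ∈ Icc (0:ℝ) r₀, ∀ R ∈ Icc (0:ℝ) r₀, 0 ≤ deriv (fun s => Ψ r s) R
  Y_origin : Y 0 0 = 1
  Yr_origin : deriv (fun s => Y s 0) 0 = 0
  YR_origin : deriv (fun s => Y 0 s) 0 = 0
  Ψ_origin : Ψ 0 0 = 0
  Ψr_origin : deriv (fun s => Ψ s 0) 0 = 0
  ΨR_origin : deriv (fun s => Ψ 0 s) 0 = 0
  Ψrr_origin : deriv (deriv (fun s => Ψ s 0)) 0 = 0
  ΨrR_origin : deriv (fun s => deriv (fun t => Ψ s t) 0) 0 = 0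
  ΨRR_origin : deriv (deriv (fun s => Ψ 0 s)) 0 = 0
  /-- Third-order Taylor expansion of `G(r,R) = 2Ψ + R(Y²−1)` at the origin. -/
  taylor : (fun p : ℝ × ℝ =>
      (2 * Ψ p.1 p.2 + p.2 * ((Y p.1 p.2) ^ 2 - 1)) -
        (h30 * p.1 ^ 3 + h21 * p.1 ^ 2 * p.2 + h12 * p.1 * p.2 ^ 2 + h03 * p.2 ^ 3))
      =o[𝓝[Icc (0:ℝ) r₀ ×ˢ Icc (0:ℝ) r₀] (0, 0)] fun p : ℝ × ℝ => (p.1 + p.2) ^ 3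
  /-- `α = h₃₀ > 0`. -/
  α_pos : 0 < h30
  /-- `P(τ) = Σ_{i+j=3} h_{ij} τ^j > 0` on `[0,1]`. -/
  P_pos : ∀ τ ∈ Icc (0:ℝ) 1, 0 < h30 + h21 * τ + h12 * τ ^ 2 + h03 * τ ^ 3
  G_pos : ∀ r R : ℝ, 0 < R → R ≤ r → r ≤ r₀ →
      0 < 2 * Ψ r R + R * ((Y r R) ^ 2 - 1)

namespace ARSData

variable (a : ARSData)

/-- `G(r,R) := 2Ψ(r,R) + R(Y(r,R)² − 1)`. -/
def G (r R : ℝ) : ℝ := 2 * a.Ψ r R + R * ((a.Y r R) ^ 2 - 1)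

/-- `H(r,R) := √(R/G(r,R))`. -/
def H (r R : ℝ) : ℝ := Real.sqrt (R / a.G r R)

/-- `u(r,R) := √(G(r,R)/R)`. -/
def u (r R : ℝ) : ℝ := Real.sqrt (a.G r R / R)

/-- `√Δ(r,R) := ∫_R^r (1/Y(r,σ)) ∂H/∂r(r,σ) dσ + H(r,r)/Y(r,r)`. -/
def sqrtΔ (r R : ℝ) : ℝ :=
  (∫ σ in R..r, (a.Y r σ)⁻¹ * deriv (fun s => a.H s σ) r) + a.H r r / a.Y r r

/-- `P(τ) := Σ_{i+j=3} h_{ij} τ^j`. -/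
def P (τ : ℝ) : ℝ := a.h30 + a.h21 * τ + a.h12 * τ ^ 2 + a.h03 * τ ^ 3

end ARSData

/-- The critical value `ξ_c = (26 + 15√3)/2`. -/
def ξc : ℝ := (26 + 15 * Real.sqrt 3) / 2

/-- A collapsing ARS model: an ARS spacetime with no shell-crossing singularities
(`√Δ > 0`), the asymptotic expansion `√Δ(r,0) = ξ r^{n−1} + o(r^{n−1})`, and an
apparent horizon `R_h`. -/
structure CollapsingARS extends ARSData where
  ξ : ℝ
  n : ℕ
  Rh : ℝ → ℝ
  ξ_pos : 0 < ξ
  n_pos : 1 ≤ n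
  sqrtΔ_pos : ∀ r ∈ Ioc (0:ℝ) r₀, ∀ R ∈ Icc (0:ℝ) r, 0 < toARSData.sqrtΔ r R
  sqrtΔ_asym : (fun r : ℝ => toARSData.sqrtΔ r 0 - ξ * r ^ (n - 1))
      =o[𝓝[>] (0:ℝ)] fun r : ℝ => r ^ (n - 1)
  Rh_pos : ∀ r ∈ Ioc (0:ℝ) r₀, 0 < Rh r
  Rh_lt : ∀ r ∈ Ioc (0:ℝ) r₀, Rh r < r
  Rh_eq : ∀ r ∈ Ioc (0:ℝ) r₀, Rh r = 2 * Ψ r (Rh r)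

namespace CollapsingARS

variable (c : CollapsingARS)

/-- The central singularity is locally naked: some radial null geodesic `R_g`
escapes from the apparent horizon back to the central singularity. -/
def LocallyNaked : Prop :=
  ∃ r₁ ∈ Ioc (0:ℝ) c.r₀, ∃ Rg : ℝ → ℝ,
    (∀ r ∈ Ioc (0:ℝ) r₁, HasDerivAt Rg
      (c.u r (Rg r) * c.sqrtΔ r (Rg r) * (c.Y r (Rg r) - c.u r (Rg r))) r) ∧
    (∀ r ∈ Ioc (0:ℝ) r₁, c.Rh r < Rg r ∧ Rg r < r) ∧
    Tendsto Rg (𝓝[>] 0) (𝓝 0) ∧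
    Tendsto (fun r => ∫ σ in (0:ℝ)..(Rg r), c.H r σ) (𝓝[>] 0) (𝓝 0)

end CollapsingARS

/-- A time-dependent scalar field on `(0, T]` which, away from `0`, is bounded, Lipschitz in
space and continuous in time has a solution on the whole of `(0, T]` with given value at `T`. -/
theorem exists_solution_Ioc {v : ℝ → ℝ → ℝ} {T : ℝ} (R₀ : ℝ)
    (hv : ∀ ε ∈ Ioo 0 T, ∃ K L : NNReal, (∀ t ∈ Icc ε T, LipschitzWith K (v t)) ∧
      (∀ R, ContinuousOn (v · R) (Icc ε T)) ∧ ∀ t ∈ Icc ε T, ∀ R, ‖v t R‖ ≤ L) :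
    ∃ f : ℝ → ℝ, f T = R₀ ∧ (∀ δ ∈ Ioo 0 T, ContinuousOn f (Icc δ T)) ∧
      ∀ t ∈ Ioo 0 T, HasDerivAt f (v t (f t)) t := by
  have hex : ∀ ε ∈ Ioo 0 T, ∃ g : ℝ → ℝ, g T = R₀ ∧
      ∀ t ∈ Icc ε T, HasDerivWithinAt g (v t (g t)) (Icc ε T) t := by
    intro ε hε
    obtain ⟨K, L, hK, hc, hL⟩ := hv ε hε
    have hpl : IsPicardLindelof v (⟨T, hε.2.le, le_rfl⟩ : Icc ε T) R₀
        (L * (T - ε).toNNReal) 0 L K :=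
      { lipschitzOnWith := fun t ht => (hK t ht).lipschitzOnWith
        continuousOn := fun R _ => hc R
        norm_le := fun t ht R _ => hL t ht R
        mul_max_le := by
          have h : 0 ≤ T - ε := by linarith [hε.2]
          simp [h] }
    exact hpl.exists_eq_forall_mem_Icc_hasDerivWithinAt₀
  choose! g hgT hg using hex
  have huniq : ∀ ε ∈ Ioo 0 T, ∀ δ ∈ Ico ε T, EqOn (g δ) (g ε) (Icc δ T) := by
    intro ε hε δ hδ
    have hδ' : δ ∈ Ioo 0 T := ⟨hε.1.trans_le hδ.1, hδ.2⟩
    obtain ⟨K, L, hK, -, -⟩ := hv δ hδ'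
    have hgε : ∀ t ∈ Icc δ T, HasDerivWithinAt (g ε) (v t (g ε t)) (Icc δ T) t := fun t ht =>
      (hg ε hε t ⟨hδ.1.trans ht.1, ht.2⟩).mono (Icc_subset_Icc_left hδ.1)
    have hIic : ∀ h : ℝ → ℝ, (∀ t ∈ Icc δ T, HasDerivWithinAt h (v t (h t)) (Icc δ T) t) →
        ∀ t ∈ Ioc δ T, HasDerivWithinAt h (v t (h t)) (Iic t) t := fun h hh t ht =>
      ((hh t (Ioc_subset_Icc_self ht)).mono (Icc_subset_Icc_right ht.2)).mono_of_mem_nhdsWithin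
        (Icc_mem_nhdsLE ht.1)
    exact ODE_solution_unique_of_mem_Icc_left (s := fun _ => univ)
      (fun t ht => (hK t (Ioc_subset_Icc_self ht)).lipschitzOnWith)
      (fun t ht => (hg δ hδ' t ht).continuousWithinAt) (hIic _ (hg δ hδ')) (fun _ _ => trivial)
      (fun t ht => (hgε t ht).continuousWithinAt) (hIic _ hgε) (fun _ _ => trivial)
      ((hgT δ hδ').trans (hgT ε hε).symm)
  have hfg : ∀ δ ∈ Ioo 0 T, EqOn (fun t => g (t / 2) t) (g (δ / 2)) (Icc δ T) := by
    intro δ hδ t ht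
    refine huniq (δ / 2) ⟨by linarith [hδ.1], by linarith [hδ.1, hδ.2]⟩ (t / 2)
      ⟨by linarith [ht.1], by linarith [ht.1, ht.2, hδ.1]⟩ ⟨by linarith [ht.1, hδ.1], ht.2⟩
  have hT : ∀ δ ∈ Ioo 0 T, δ / 2 ∈ Ioo 0 T := fun δ hδ =>
    ⟨by linarith [hδ.1], by linarith [hδ.1, hδ.2]⟩
  by_cases hT0 : 0 < T
  swap
  · exact ⟨fun _ => R₀, rfl, fun δ hδ => absurd (hδ.1.trans hδ.2) hT0,
      fun t ht => absurd (ht.1.trans ht.2) hT0⟩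
  refine ⟨fun t => g (t / 2) t, hgT _ ⟨by linarith, by linarith⟩, fun δ hδ => ?_, fun t ht => ?_⟩
  · refine ContinuousOn.congr (fun t ht => ?_) (hfg δ hδ)
    exact (hg _ (hT δ hδ) t ⟨by linarith [ht.1, hδ.1], ht.2⟩).continuousWithinAt.mono
      (Icc_subset_Icc_left (by linarith [hδ.1]))
  · have ht2 := hT t ht
    have hmem : Icc (t / 2) T ∈ 𝓝 t := Icc_mem_nhds (by linarith [ht.1]) ht.2
    have heq := hfg _ ht2
    have hd := (hg _ (hT _ ht2) t ⟨by linarith [ht.1], ht.2.le⟩).hasDerivAt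
      (Icc_mem_nhds (by linarith [ht.1]) ht.2)
    rw [← heq ⟨by linarith [ht.1], ht.2.le⟩] at hd
    exact hd.congr_of_eventuallyEq (heq.eventuallyEq_of_mem hmem)

/-- `f` is Lipschitz in its second variable on `K`, uniformly in the first one. -/
def LipschitzInSnd (f : ℝ × ℝ → ℝ) (K : Set (ℝ × ℝ)) : Prop :=
  ∃ C : ℝ, ∀ p ∈ K, ∀ q ∈ K, p.1 = q.1 → |f p - f q| ≤ C * |p.2 - q.2|

theorem LipschitzInSnd.sub {f g : ℝ × ℝ → ℝ} {K : Set (ℝ × ℝ)} (hf : LipschitzInSnd f K)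
    (hg : LipschitzInSnd g K) : LipschitzInSnd (fun p => f p - g p) K := by
  obtain ⟨A, hA⟩ := hf
  obtain ⟨B, hB⟩ := hg
  refine ⟨A + B, fun p hp q hq h => ?_⟩
  calc |f p - g p - (f q - g q)| = |(f p - f q) - (g p - g q)| := by ring_nf
    _ ≤ |f p - f q| + |g p - g q| := abs_sub _ _
    _ ≤ (A + B) * |p.2 - q.2| := by linarith [hA p hp q hq h, hB p hp q hq h]

theorem LipschitzInSnd.mul {f g : ℝ × ℝ → ℝ} {K : Set (ℝ × ℝ)} (hK : IsCompact K)
    (hfc : ContinuousOn f K) (hgc : ContinuousOn g K) (hf : LipschitzInSnd f K)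
    (hg : LipschitzInSnd g K) : LipschitzInSnd (fun p => f p * g p) K := by
  obtain ⟨A, hA⟩ := hf
  obtain ⟨B, hB⟩ := hg
  obtain ⟨M, hM⟩ := hK.exists_bound_of_continuousOn hfc
  obtain ⟨N, hN⟩ := hK.exists_bound_of_continuousOn hgc
  refine ⟨M * B + N * A, fun p hp q hq h => ?_⟩
  have h1 : |f p| * |g p - g q| ≤ M * (B * |p.2 - q.2|) :=
    mul_le_mul (hM p hp) (hB p hp q hq h) (abs_nonneg _) ((norm_nonneg _).trans (hM p hp))
  have h2 : |g q| * |f p - f q| ≤ N * (A * |p.2 - q.2|) :=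
    mul_le_mul (hN q hq) (hA p hp q hq h) (abs_nonneg _) ((norm_nonneg _).trans (hN q hq))
  calc |f p * g p - f q * g q| = |f p * (g p - g q) + g q * (f p - f q)| := by ring_nf
    _ ≤ |f p * (g p - g q)| + |g q * (f p - f q)| := abs_add_le _ _
    _ ≤ (M * B + N * A) * |p.2 - q.2| := by rw [abs_mul, abs_mul]; linarith

theorem LipschitzOnWith.lipschitzInSnd {f : ℝ × ℝ → ℝ} {K : Set (ℝ × ℝ)} {C : NNReal}
    (hf : LipschitzOnWith C f K) : LipschitzInSnd f K := by
  refine ⟨C, fun p hp q hq h => ?_⟩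
  have := hf.dist_le_mul p hp q hq
  rwa [Prod.dist_eq, h, dist_self, max_eq_right dist_nonneg, Real.dist_eq, Real.dist_eq] at this

/-- The compact triangle `m ≤ R ≤ r ≤ T` in the `(r, R)`-plane. -/
def triangle (m T : ℝ) : Set (ℝ × ℝ) := {p | m ≤ p.2 ∧ p.2 ≤ p.1 ∧ p.1 ≤ T}

theorem isCompact_triangle (m T : ℝ) : IsCompact (triangle m T) := by
  refine (isCompact_Icc.prod isCompact_Icc : IsCompact (Icc m T ×ˢ Icc m T)).of_isClosed_subset
    ?_ ?_
  · exact (isClosed_le continuous_const continuous_snd).inter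
      ((isClosed_le continuous_snd continuous_fst).inter
        (isClosed_le continuous_fst continuous_const))
  · rintro ⟨r, R⟩ ⟨h1, h2, h3⟩
    exact ⟨⟨h1.trans h2, h3⟩, ⟨h1, h2.trans h3⟩⟩

theorem convex_triangle (m T : ℝ) : Convex ℝ (triangle m T) := by
  rintro ⟨r, R⟩ ⟨h1, h2, h3⟩ ⟨s, S⟩ ⟨k1, k2, k3⟩ a b ha hb hab
  simp only [triangle, mem_ofPred_eq, Prod.smul_mk, Prod.mk_add_mk, smul_eq_mul] at *
  obtain rfl : b = 1 - a := by linarith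
  refine ⟨?_, ?_, ?_⟩ <;> nlinarith

/-- A retraction of the plane onto the triangle `m ≤ R ≤ r ≤ T`. -/
theorem exists_retract_triangle {m T : ℝ} (hmT : m ≤ T) :
    ∃ ρ : ℝ × ℝ → ℝ × ℝ, Continuous ρ ∧ (∀ p, ρ p ∈ triangle m T) ∧
      ∀ p ∈ triangle m T, ρ p = p := by
  refine ⟨fun p => (max m (min p.1 T), max m (min p.2 (max m (min p.1 T)))), by fun_prop, ?_, ?_⟩
  · intro p
    exact ⟨le_max_left _ _, max_le (le_max_left _ _) (min_le_right _ _),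
      max_le hmT (min_le_right _ _)⟩
  · rintro ⟨r, R⟩ ⟨h1, h2, h3⟩
    simp only at h1 h2 h3
    simp [h2, h3, h1, h1.trans h2]

namespace ARSData

variable (a : ARSData)

/-- The right-hand side of the radial null geodesic equation. -/
def nullField (r R : ℝ) : ℝ := a.u r R * a.sqrtΔ r R * (a.Y r R - a.u r R)

/-- The integrand `Y⁻¹ ∂H/∂r` in the definition of `√Δ`. -/
def kernelΔ (p : ℝ × ℝ) : ℝ := (a.Y p.1 p.2)⁻¹ * deriv (fun s => a.H s p.2) p.1

theorem exists_isOpen_contDiffOn : ∃ V : Set (ℝ × ℝ), IsOpen V ∧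
    (∀ m, 0 < m → triangle m a.r₀ ⊆ V) ∧
    ContDiffOn ℝ 1 (fun p : ℝ × ℝ => a.Y p.1 p.2) V ∧
    ContDiffOn ℝ 1 (fun p : ℝ × ℝ => a.u p.1 p.2) V ∧
    ContDiffOn ℝ 1 (fun p : ℝ × ℝ => a.H p.1 p.2) V := by
  obtain ⟨U, hU, hsub, hΨ, hY⟩ := a.smooth
  have hΨ1 := hΨ.of_le (m := 1) (by norm_cast)
  have hY1 := hY.of_le (m := 1) (by norm_cast)
  have hG : ContDiffOn ℝ 1 (fun p : ℝ × ℝ => a.G p.1 p.2) U :=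
    (contDiffOn_const.mul hΨ1).add (contDiffOn_snd.mul ((hY1.pow 2).sub contDiffOn_const))
  refine ⟨U ∩ (fun p : ℝ × ℝ => (a.G p.1 p.2, p.2)) ⁻¹' (Ioi 0 ×ˢ Ioi 0), ?_, ?_, ?_, ?_, ?_⟩
  · exact (hG.continuousOn.prodMk continuousOn_snd).isOpen_inter_preimage hU
      (isOpen_Ioi.prod isOpen_Ioi)
  · rintro m hm ⟨r, R⟩ ⟨h1, h2, h3⟩
    simp only at h1 h2 h3
    exact ⟨hsub ⟨⟨by simp only; linarith, h3⟩, ⟨by simp only; linarith, h2.trans h3⟩⟩,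
      a.G_pos r R (hm.trans_le h1) h2 h3, hm.trans_le h1⟩
  · exact hY1.mono inter_subset_left
  · refine ContDiffOn.sqrt ((hG.mono inter_subset_left).div contDiffOn_snd ?_) ?_
    · rintro p ⟨-, -, hp⟩
      exact ne_of_gt hp
    · rintro p ⟨-, hp, hp'⟩
      exact (div_pos hp hp').ne'
  · refine ContDiffOn.sqrt (contDiffOn_snd.div (hG.mono inter_subset_left) ?_) ?_
    · rintro p ⟨-, hp, -⟩
      exact ne_of_gt hp
    · rintro p ⟨-, hp, hp'⟩
      exact (div_pos hp' hp).ne'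

theorem Y_pos_of_mem_triangle {m : ℝ} (hm : 0 < m) {p : ℝ × ℝ} (hp : p ∈ triangle m a.r₀) :
    0 < a.Y p.1 p.2 := by
  obtain ⟨h1, h2, h3⟩ := hp
  exact a.Y_pos _ ⟨by linarith, h3⟩ _ ⟨by linarith, h2.trans h3⟩

theorem continuousOn_kernelΔ {m : ℝ} (hm : 0 < m) :
    ContinuousOn a.kernelΔ (triangle m a.r₀) := by
  obtain ⟨V, hV, hsub, hY, -, hH⟩ := a.exists_isOpen_contDiffOn
  refine ContinuousOn.mul ((hY.continuousOn.mono (hsub m hm)).inv₀ fun p hp =>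
    (a.Y_pos_of_mem_triangle hm hp).ne') (ContinuousOn.congr (f := fun p =>
      fderiv ℝ (fun p : ℝ × ℝ => a.H p.1 p.2) p (1, 0)) ?_ ?_)
  · exact ((hH.continuousOn_fderiv_of_isOpen hV le_rfl).mono (hsub m hm)).clm_apply
      continuousOn_const
  · rintro ⟨r, R⟩ hp
    have h1 : HasFDerivAt (fun p : ℝ × ℝ => a.H p.1 p.2)
        (fderiv ℝ (fun p : ℝ × ℝ => a.H p.1 p.2) (r, R)) (r, R) :=
      ((hH.contDiffAt (hV.mem_nhds (hsub m hm hp))).differentiableAt one_ne_zero).hasFDerivAt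
    have h2 : HasDerivAt (fun s : ℝ => (s, R)) (1, 0) r :=
      (hasDerivAt_id r).prodMk (hasDerivAt_const r R)
    exact (h1.comp_hasDerivAt r h2).deriv

theorem sqrtΔ_regular {m : ℝ} (hm : 0 < m) (hmr : m ≤ a.r₀) :
    ContinuousOn (fun p : ℝ × ℝ => a.sqrtΔ p.1 p.2) (triangle m a.r₀) ∧
      LipschitzInSnd (fun p : ℝ × ℝ => a.sqrtΔ p.1 p.2) (triangle m a.r₀) := by
  obtain ⟨V, hV, hsub, hY, -, hH⟩ := a.exists_isOpen_contDiffOn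
  obtain ⟨ρ, hρc, hρm, hρ⟩ := exists_retract_triangle hmr
  have hkc := a.continuousOn_kernelΔ hm
  have hgc : Continuous (fun p => a.kernelΔ (ρ p)) := hkc.comp_continuous hρc hρm
  have hgr : ∀ r, Continuous (fun σ => a.kernelΔ (ρ (r, σ))) := fun r =>
    hgc.comp (by fun_prop)
  have hint : ∀ r x y, IntervalIntegrable (fun σ => a.kernelΔ (ρ (r, σ))) volume x y :=
    fun r x y => (hgr r).intervalIntegrable x y
  have hker : ∀ p ∈ triangle m a.r₀, (∫ σ in p.2..p.1, (a.Y p.1 σ)⁻¹ *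
      deriv (fun s => a.H s σ) p.1) = ∫ σ in p.2..p.1, a.kernelΔ (ρ (p.1, σ)) := by
    rintro ⟨r, R⟩ ⟨h1, h2, h3⟩
    refine intervalIntegral.integral_congr fun σ hσ => ?_
    simp only at h1 h2 h3 hσ
    rw [uIcc_of_le h2] at hσ
    simp only
    rw [hρ (r, σ) ⟨h1.trans hσ.1, hσ.2, h3⟩, kernelΔ]
  constructor
  · refine ContinuousOn.add (ContinuousOn.congr (f := fun p : ℝ × ℝ =>
      (∫ σ in m..p.1, a.kernelΔ (ρ (p.1, σ))) - ∫ σ in m..p.2, a.kernelΔ (ρ (p.1, σ))) ?_ ?_) ?_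
    · refine Continuous.continuousOn (Continuous.sub ?_ ?_)
      · exact intervalIntegral.continuous_parametric_intervalIntegral_of_continuous
          (f := fun (p : ℝ × ℝ) σ => a.kernelΔ (ρ (p.1, σ)))
          (hgc.comp (by fun_prop)) continuous_fst
      · exact intervalIntegral.continuous_parametric_intervalIntegral_of_continuous
          (f := fun (p : ℝ × ℝ) σ => a.kernelΔ (ρ (p.1, σ)))
          (hgc.comp (by fun_prop)) continuous_snd
    · intro p hp
      simp only
      rw [hker p hp, intervalIntegral.integral_interval_sub_left (hint _ _ _) (hint _ _ _)]
    · have hdiag : MapsTo (fun p : ℝ × ℝ => (p.1, p.1)) (triangle m a.r₀) (triangle m a.r₀) :=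
        fun p hp => ⟨hp.1.trans hp.2.1, le_rfl, hp.2.2⟩
      have hdc : ContinuousOn (fun p : ℝ × ℝ => (p.1, p.1)) (triangle m a.r₀) := by fun_prop
      refine ContinuousOn.div ?_ ?_ fun p hp => (a.Y_pos_of_mem_triangle hm (hdiag hp)).ne'
      · exact (hH.continuousOn.mono (hsub m hm)).comp hdc hdiag
      · exact (hY.continuousOn.mono (hsub m hm)).comp hdc hdiag
  · obtain ⟨M, hM⟩ := (isCompact_triangle m a.r₀).exists_bound_of_continuousOn hkc
    refine ⟨M, fun p hp q hq hpq => ?_⟩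
    have h : a.sqrtΔ p.1 p.2 - a.sqrtΔ q.1 q.2 = ∫ σ in p.2..q.2, a.kernelΔ (ρ (p.1, σ)) := by
      rw [sqrtΔ, sqrtΔ, hker p hp, hker q hq, ← hpq,
        ← intervalIntegral.integral_add_adjacent_intervals (hint p.1 p.2 q.2) (hint p.1 q.2 p.1)]
      ring
    simp only
    rw [h, ← Real.norm_eq_abs, abs_sub_comm]
    exact intervalIntegral.norm_integral_le_of_norm_le_const fun σ _ => hM _ (hρm _)

theorem nullField_regular {m : ℝ} (hm : 0 < m) (hmr : m ≤ a.r₀) :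
    ContinuousOn (fun p : ℝ × ℝ => a.nullField p.1 p.2) (triangle m a.r₀) ∧
      LipschitzInSnd (fun p : ℝ × ℝ => a.nullField p.1 p.2) (triangle m a.r₀) := by
  obtain ⟨V, hV, hsub, hY, hu, -⟩ := a.exists_isOpen_contDiffOn
  obtain ⟨hSc, hSl⟩ := a.sqrtΔ_regular hm hmr
  have hK := isCompact_triangle m a.r₀
  have hYm := hY.mono (hsub m hm)
  have hum := hu.mono (hsub m hm)
  obtain ⟨A, hA⟩ := hYm.exists_lipschitzOnWith one_ne_zero (convex_triangle _ _) hK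
  obtain ⟨B, hB⟩ := hum.exists_lipschitzOnWith one_ne_zero (convex_triangle _ _) hK
  have hYc := hYm.continuousOn
  have huc := hum.continuousOn
  exact ⟨(huc.mul hSc).mul (hYc.sub huc), LipschitzInSnd.mul hK (huc.mul hSc) (hYc.sub huc)
    (LipschitzInSnd.mul hK huc hSc hB.lipschitzInSnd hSl)
    (hA.lipschitzInSnd.sub hB.lipschitzInSnd)⟩

end ARSData

namespace ARSData

variable (a : ARSData)

theorem exists_cubic_le_G : ∃ p > 0, ∃ δ > 0, ∀ r ∈ Ioc 0 (min δ a.r₀), ∀ R ∈ Icc 0 r,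
    p * r ^ 3 ≤ a.G r R := by
  have hPc : Continuous a.P := by unfold P; fun_prop
  obtain ⟨τ₀, hτ₀, hmin⟩ := (isCompact_Icc (a := (0 : ℝ)) (b := 1)).exists_isMinOn
    (nonempty_Icc.2 zero_le_one) hPc.continuousOn
  have hp : 0 < a.P τ₀ := a.P_pos τ₀ hτ₀
  have hev := a.taylor.def (show 0 < a.P τ₀ / 16 by positivity)
  obtain ⟨δ, hδ, hball⟩ := Metric.mem_nhdsWithin_iff.1 hev
  refine ⟨a.P τ₀ / 2, by positivity, δ / 2, by positivity, fun r hr R hR => ?_⟩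
  obtain ⟨hr0, hr1⟩ := hr
  obtain ⟨hr1, hr2⟩ := le_min_iff.1 hr1
  have hmem := hball (a := (r, R)) ⟨by
    rw [Metric.mem_ball, Prod.dist_eq, Real.dist_eq, Real.dist_eq, sub_zero, sub_zero,
      abs_of_pos hr0, abs_of_nonneg hR.1, max_lt_iff]
    constructor <;> linarith [hR.2], ⟨hr0.le, hr2⟩, ⟨hR.1, hR.2.trans hr2⟩⟩
  simp only [mem_ofPred_eq, Real.norm_eq_abs] at hmem
  rw [abs_of_nonneg (show 0 ≤ (r + R) ^ 3 by have := hR.1; positivity)] at hmem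
  have hcube : (r + R) ^ 3 ≤ 8 * r ^ 3 := by
    calc (r + R) ^ 3 ≤ (2 * r) ^ 3 := by
          have := hR.1
          gcongr
          linarith [hR.2]
      _ = 8 * r ^ 3 := by ring
  have hP : a.P τ₀ ≤ a.P (R / r) := hmin ⟨by have := hR.1; positivity, (div_le_one hr0).2 hR.2⟩
  have hPr : r ^ 3 * a.P (R / r) =
      a.h30 * r ^ 3 + a.h21 * r ^ 2 * R + a.h12 * r * R ^ 2 + a.h03 * R ^ 3 := by
    unfold P
    field_simp
  have h1 : r ^ 3 * a.P τ₀ ≤ r ^ 3 * a.P (R / r) := by gcongr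
  have h2 := mul_le_mul_of_nonneg_left hcube (show 0 ≤ a.P τ₀ / 16 by positivity)
  have h3 := (abs_le.1 hmem).1
  unfold G
  linarith

theorem contDiffAt_Ψ : ∀ r ∈ Icc 0 a.r₀, ∀ R ∈ Icc 0 a.r₀,
    ContDiffAt ℝ 1 (fun p : ℝ × ℝ => a.Ψ p.1 p.2) (r, R) := by
  obtain ⟨U, hU, hsub, hΨ, -⟩ := a.smooth
  exact fun r hr R hR =>
    ((hΨ.of_le (by norm_cast)).contDiffAt (hU.mem_nhds (hsub ⟨hr, hR⟩)))

theorem monotoneOn_Ψ_fst {R : ℝ} (hR : R ∈ Icc 0 a.r₀) :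
    MonotoneOn (fun r => a.Ψ r R) (Icc 0 a.r₀) := by
  have hd : ∀ r ∈ Icc 0 a.r₀, DifferentiableAt ℝ (fun r => a.Ψ r R) r := fun r hr =>
    ((a.contDiffAt_Ψ r hr R hR).differentiableAt one_ne_zero).comp r
      (f := fun r : ℝ => (r, R)) (by fun_prop)
  exact monotoneOn_of_deriv_nonneg (convex_Icc _ _)
    (fun r hr => (hd r hr).continuousAt.continuousWithinAt)
    (fun r hr => (hd r (interior_subset hr)).differentiableWithinAt)
    fun r hr => a.Ψr_nonneg r (interior_subset hr) R hR

theorem monotoneOn_Ψ_snd {r : ℝ} (hr : r ∈ Icc 0 a.r₀) :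
    MonotoneOn (a.Ψ r) (Icc 0 a.r₀) := by
  have hd : ∀ R ∈ Icc 0 a.r₀, DifferentiableAt ℝ (a.Ψ r) R := fun R hR =>
    ((a.contDiffAt_Ψ r hr R hR).differentiableAt one_ne_zero).comp R
      (f := fun R : ℝ => (r, R)) (by fun_prop)
  exact monotoneOn_of_deriv_nonneg (convex_Icc _ _)
    (fun R hR => (hd R hR).continuousAt.continuousWithinAt)
    (fun R hR => (hd R (interior_subset hR)).differentiableWithinAt)
    fun R hR => a.ΨR_nonneg r hr R (interior_subset hR)

theorem exists_Ψ_lipschitz : ∃ δ > 0, ∀ r ∈ Ico 0 δ, ∀ R ∈ Ico 0 δ, ∀ R' ∈ Ico 0 δ,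
    |a.Ψ r R - a.Ψ r R'| ≤ 1 / 4 * |R - R'| := by
  have h0 : (0 : ℝ) ∈ Icc 0 a.r₀ := ⟨le_rfl, a.r₀_pos.le⟩
  have hc := a.contDiffAt_Ψ 0 h0 0 h0
  have hs := hc.hasStrictFDerivAt one_ne_zero
  set f' := fderiv ℝ (fun p : ℝ × ℝ => a.Ψ p.1 p.2) (0, 0)
  have h1 : f' (1, 0) = 0 := by
    have h2 : HasDerivAt (fun s : ℝ => (s, (0 : ℝ))) (1, 0) 0 :=
      (hasDerivAt_id _).prodMk (hasDerivAt_const _ _)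
    exact (hs.hasFDerivAt.comp_hasDerivAt (f := fun s : ℝ => (s, (0 : ℝ))) 0 h2).deriv.symm.trans
      a.Ψr_origin
  have h2 : f' (0, 1) = 0 := by
    have h2 : HasDerivAt (fun s : ℝ => ((0 : ℝ), s)) (0, 1) 0 :=
      (hasDerivAt_const _ _).prodMk (hasDerivAt_id _)
    exact (hs.hasFDerivAt.comp_hasDerivAt (f := fun s : ℝ => ((0 : ℝ), s)) 0 h2).deriv.symm.trans
      a.ΨR_origin
  have hf' : f' = 0 := by
    ext
    · simpa using h1
    · simpa using h2
  obtain ⟨s, hs, hl⟩ := hs.exists_lipschitzOnWith_of_nnnorm_lt (1 / 4) (by rw [hf']; simp)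
  obtain ⟨δ, hδ, hball⟩ := Metric.mem_nhds_iff.1 hs
  have hmem : ∀ r ∈ Ico 0 δ, ∀ R ∈ Ico 0 δ, (r, R) ∈ s := fun r hr R hR => hball <| by
    rw [Metric.mem_ball, Prod.dist_eq, Real.dist_eq, Real.dist_eq, sub_zero, sub_zero,
      abs_of_nonneg hr.1, abs_of_nonneg hR.1, max_lt_iff]
    exact ⟨hr.2, hR.2⟩
  refine ⟨δ, hδ, fun r hr R hR R' hR' => ?_⟩
  have := hl.dist_le_mul _ (hmem r hr R hR) _ (hmem r hr R' hR')
  rw [Prod.dist_eq, dist_self, max_eq_right dist_nonneg, Real.dist_eq, Real.dist_eq] at this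
  simpa using this

end ARSData

namespace CollapsingARS

variable (c : CollapsingARS)

/-- Inside the trapped region the null geodesic field is nonpositive. -/
theorem nullField_nonpos {r R : ℝ} (hR : 0 < R) (hRr : R ≤ r) (hr : r ≤ c.r₀)
    (h : R ≤ 2 * c.Ψ r R) : c.nullField r R ≤ 0 := by
  have hr0 : 0 < r := hR.trans_le hRr
  have hY := c.Y_pos r ⟨hr0.le, hr⟩ R ⟨hR.le, hRr.trans hr⟩
  have hu : c.Y r R ≤ c.u r R := by
    refine Real.le_sqrt_of_sq_le ((le_div_iff₀ hR).2 ?_)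
    unfold ARSData.G
    nlinarith
  exact mul_nonpos_of_nonneg_of_nonpos
    (mul_nonneg (Real.sqrt_nonneg _) (c.sqrtΔ_pos r ⟨hr0, hr⟩ R ⟨hR.le, hRr⟩).le)
    (sub_nonpos.2 hu)

/-- If `x r³` is a strict subsolution and `b r³` lies below the apparent horizon, some radial
null geodesic stays between the apparent horizon and `x r³`. -/
theorem exists_geodesic_le_cubic {b x T : ℝ} (hb : 0 < b) (hbx : b < x)
    (hT : T ∈ Ioc 0 c.r₀) (hxT : x * T ^ 2 ≤ 1)
    (hlow : ∀ t ∈ Ioc 0 T, b * t ^ 3 ≤ 2 * c.Ψ t 0)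
    (hsub : ∀ t ∈ Ioc 0 T, 3 * x * t ^ 2 < c.nullField t (x * t ^ 3)) :
    ∃ f : ℝ → ℝ, ∀ t ∈ Ioo 0 T, HasDerivAt f (c.nullField t (f t)) t ∧
      0 < f t ∧ f t ≤ x * t ^ 3 ∧ 2 * c.Ψ t (f t) < f t := by
  have hx : 0 < x := hb.trans hbx
  have hxt : ∀ t ∈ Ioc 0 T, x * t ^ 3 ≤ t := by
    intro t ht
    have h1 : x * t ^ 2 ≤ 1 := le_trans (by have := ht.1; have := ht.2; gcongr) hxT
    calc x * t ^ 3 = x * t ^ 2 * t := by ring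
      _ ≤ 1 * t := by have := ht.1; gcongr
      _ = t := one_mul t
  have hbt : ∀ t ∈ Ioc 0 T, b * t ^ 3 < x * t ^ 3 := fun t ht => by
    have := pow_pos ht.1 3
    gcongr
  set κ : ℝ → ℝ → ℝ := fun t R => max (b * t ^ 3) (min R (x * t ^ 3)) with hκ
  have hκl : ∀ t R, b * t ^ 3 ≤ κ t R := fun t R => le_max_left _ _
  have hκu : ∀ t ∈ Ioc 0 T, ∀ R, κ t R ≤ x * t ^ 3 := fun t ht R =>
    max_le (hbt t ht).le (min_le_right _ _)
  have hκ0 : ∀ t ∈ Ioc 0 T, ∀ R, 0 < κ t R := fun t ht R =>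
    (mul_pos hb (pow_pos ht.1 3)).trans_le (hκl t R)
  have hκlip : ∀ t R R', |κ t R - κ t R'| ≤ |R - R'| := by
    intro t R R'
    have h1 := abs_max_sub_max_le_abs (min R (x * t ^ 3)) (min R' (x * t ^ 3)) (b * t ^ 3)
    have h2 := abs_min_sub_min_le_max R (x * t ^ 3) R' (x * t ^ 3)
    rw [sub_self, abs_zero, max_eq_left (abs_nonneg _)] at h2
    simp only [hκ]
    rw [max_comm, max_comm (b * t ^ 3)]
    exact h1.trans h2
  have hreg : ∀ ε ∈ Ioo 0 T, ∃ K L : NNReal,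
      (∀ t ∈ Icc ε T, LipschitzWith K (fun R => c.nullField t (κ t R))) ∧
      (∀ R, ContinuousOn (fun t => c.nullField t (κ t R)) (Icc ε T)) ∧
      ∀ t ∈ Icc ε T, ∀ R, ‖c.nullField t (κ t R)‖ ≤ L := by
    intro ε hε
    have hεT : ∀ t ∈ Icc ε T, t ∈ Ioc 0 T := fun t ht => ⟨hε.1.trans_le ht.1, ht.2⟩
    have hm : 0 < b * ε ^ 3 := mul_pos hb (pow_pos hε.1 3)
    have hεε := hεT ε ⟨le_rfl, hε.2.le⟩
    have hmr : b * ε ^ 3 ≤ c.r₀ := by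
      linarith [hbt ε hεε, hxt ε hεε, hε.2, hT.2]
    have hmem : ∀ t ∈ Icc ε T, ∀ R, (t, κ t R) ∈ triangle (b * ε ^ 3) c.r₀ := by
      intro t ht R
      refine ⟨le_trans ?_ (hκl t R), (hκu t (hεT t ht) R).trans (hxt t (hεT t ht)),
        ht.2.trans hT.2⟩
      have := hε.1.le
      have := ht.1
      gcongr
    obtain ⟨hFc, C, hC⟩ := c.nullField_regular hm hmr
    obtain ⟨L, hL⟩ := (isCompact_triangle (b * ε ^ 3) c.r₀).exists_bound_of_continuousOn hFc
    refine ⟨C.toNNReal, L.toNNReal, fun t ht => ?_, fun R => ?_, fun t ht R => ?_⟩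
    · refine LipschitzWith.of_dist_le_mul fun R R' => ?_
      rw [Real.dist_eq, Real.dist_eq]
      calc |c.nullField t (κ t R) - c.nullField t (κ t R')| ≤ C * |κ t R - κ t R'| :=
            hC _ (hmem t ht R) _ (hmem t ht R') rfl
        _ ≤ C.toNNReal * |R - R'| := mul_le_mul (Real.le_coe_toNNReal C) (hκlip t R R')
            (abs_nonneg _) C.toNNReal.coe_nonneg
    · exact hFc.comp (f := fun t => (t, κ t R)) (by fun_prop) fun t ht => hmem t ht R
    · exact (hL _ (hmem t ht R)).trans (Real.le_coe_toNNReal L)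
  obtain ⟨f, hfT, hfc, hfd⟩ := exists_solution_Ioc (x * T ^ 3) hreg
  have hupper : ∀ t ∈ Ioo 0 T, f t ≤ x * t ^ 3 := by
    intro t₀ ht₀
    by_contra! hlt
    have hcub : ∀ t, HasDerivAt (fun t => x * t ^ 3) (3 * x * t ^ 2) t := fun t =>
      ((hasDerivAt_pow 3 t).const_mul x).congr_deriv (by push_cast; ring)
    have key := image_le_of_deriv_right_lt_deriv_boundary (a := t₀) (b := T)
      (f := fun t => x * t ^ 3 - f t)
      (f' := fun t => 3 * x * t ^ 2 - c.nullField t (κ t (f t)))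
      (B := fun _ => x * t₀ ^ 3 - f t₀) (B' := fun _ => 0)
      (ContinuousOn.sub (by fun_prop) (hfc t₀ ht₀))
      (fun t ht => ((hcub t).sub (hfd t ⟨ht₀.1.trans_le ht.1, ht.2⟩)).hasDerivWithinAt)
      le_rfl (fun t => hasDerivAt_const _ _) (fun t ht heq => ?_)
    · have := key ⟨ht₀.2.le, le_rfl⟩
      simp only [hfT] at this
      linarith
    · have htT : t ∈ Ioc 0 T := ⟨ht₀.1.trans_le ht.1, ht.2.le⟩
      have h1 : κ t (f t) = x * t ^ 3 := by
        simp only [hκ]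
        rw [min_eq_right (by linarith), max_eq_right (hbt t htT).le]
      simp only [h1]
      linarith [hsub t htT]
  have hlower : ∀ t ∈ Ioo 0 T, b * t ^ 3 < f t ∧ 2 * c.Ψ t (f t) < f t := by
    intro t₀ ht₀
    by_contra hcon
    have ht₀' : t₀ ∈ Ioc 0 T := ⟨ht₀.1, ht₀.2.le⟩
    have hneg : ∀ t ∈ Ico t₀ T, c.nullField t (κ t (f t₀)) ≤ 0 := by
      intro t ht
      have htT : t ∈ Ioc 0 T := ⟨ht₀.1.trans_le ht.1, ht.2.le⟩
      have htr : t ≤ c.r₀ := htT.2.trans hT.2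
      have hκt := (hκu t htT (f t₀)).trans (hxt t htT)
      refine c.nullField_nonpos (hκ0 t htT _) hκt htr ?_
      have hmem0 : (0 : ℝ) ∈ Icc 0 c.r₀ := ⟨le_rfl, c.r₀_pos.le⟩
      have htm : t ∈ Icc 0 c.r₀ := ⟨htT.1.le, htr⟩
      have hκm : κ t (f t₀) ∈ Icc 0 c.r₀ := ⟨(hκ0 t htT _).le, hκt.trans htr⟩
      rcases le_or_gt (f t₀) (b * t ^ 3) with hle | hgt
      · have h1 : κ t (f t₀) = b * t ^ 3 := max_eq_left ((min_le_left _ _).trans hle)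
        have h2 := c.monotoneOn_Ψ_snd htm hmem0 hκm hκm.1
        linarith [hlow t htT]
      · have hcube : t₀ ^ 3 ≤ t ^ 3 := pow_le_pow_left₀ ht₀.1.le ht.1 3
        have h1 : κ t (f t₀) = f t₀ := by
          simp only [hκ]
          rw [min_eq_left ((hupper t₀ ht₀).trans (by gcongr)), max_eq_right hgt.le]
        have hle : f t₀ ≤ 2 * c.Ψ t₀ (f t₀) := by
          by_contra! hlt
          exact hcon ⟨lt_of_le_of_lt (by gcongr) hgt, hlt⟩
        rw [h1] at hκm ⊢
        have h2 := c.monotoneOn_Ψ_fst hκm ⟨ht₀.1.le, ht₀.2.le.trans hT.2⟩ htm ht.1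
        simp only at h2
        linarith
    obtain ⟨K, -, hK, -⟩ := hreg t₀ ht₀
    have hgap : 0 < x * T ^ 3 - f t₀ := by
      have h1 : t₀ ^ 3 < T ^ 3 := pow_lt_pow_left₀ ht₀.2 ht₀.1.le (by norm_num)
      have h2 : x * t₀ ^ 3 < x * T ^ 3 := by gcongr
      linarith [hupper t₀ ht₀]
    set E : ℝ := Real.exp ((K + 1) * (T - t₀)) with hE
    set η : ℝ := (x * T ^ 3 - f t₀) / (2 * E) with hη
    have hE0 : 0 < E := Real.exp_pos _
    have hη0 : 0 < η := by positivity
    have key := image_le_of_deriv_right_lt_deriv_boundary (a := t₀) (b := T)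
      (f := f) (f' := fun t => c.nullField t (κ t (f t)))
      (B := fun t => f t₀ + η * Real.exp ((K + 1) * (t - t₀)))
      (B' := fun t => η * (Real.exp ((K + 1) * (t - t₀)) * (K + 1)))
      (hfc t₀ ht₀) (fun t ht => (hfd t ⟨ht₀.1.trans_le ht.1, ht.2⟩).hasDerivWithinAt)
      (by simp [hη0.le]) (fun t => ?_) (fun t ht heq => ?_)
    · have h1 := key ⟨ht₀.2.le, le_rfl⟩
      simp only [hfT, ← hE] at h1
      have h2 : η * E = (x * T ^ 3 - f t₀) / 2 := by
        rw [hη]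
        field_simp
      linarith
    · have h1 : HasDerivAt (fun t : ℝ => ((K : ℝ) + 1) * (t - t₀)) (K + 1) t := by
        simpa using ((hasDerivAt_id t).sub_const t₀).const_mul ((K : ℝ) + 1)
      exact (h1.exp.const_mul η).const_add (f t₀)
    · have hpos : 0 < η * Real.exp ((K + 1) * (t - t₀)) := by positivity
      have h1 := (hK t ⟨ht.1, ht.2.le⟩).dist_le_mul (f t) (f t₀)
      rw [Real.dist_eq, Real.dist_eq, heq, add_sub_cancel_left, abs_of_pos hpos] at h1
      have h2 := le_of_abs_le h1
      rw [← heq] at h2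
      linarith [hneg t ht]
  refine ⟨f, fun t ht => ?_⟩
  have htT : t ∈ Ioc 0 T := ⟨ht.1, ht.2.le⟩
  obtain ⟨h1, h2⟩ := hlower t ht
  have hκf : κ t (f t) = f t := by
    simp only [hκ]
    rw [min_eq_left (hupper t ht), max_eq_right h1.le]
  have hd := hfd t ht
  rw [hκf] at hd
  exact ⟨hd, (mul_pos hb (pow_pos ht.1 3)).trans h1, hupper t ht, h2⟩

end CollapsingARS

/-- **Lemma (nakedness from a cubic subsolution).** In a collapsing ARS model, if for
some `x > α` the curve `r ↦ x r³` is a strict subsolution of the radial null geodesic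
equation on some interval `(0, r₁]`, then the central singularity is locally naked. -/
theorem naked_of_cubic_subsolution (c : CollapsingARS) (x : ℝ) (hx : c.h30 < x)
    (r₁ : ℝ) (hr₁ : r₁ ∈ Ioc (0:ℝ) c.r₀)
    (hsub : ∀ r ∈ Ioc (0:ℝ) r₁,
      3 * x * r ^ 2 <
        c.u r (x * r ^ 3) * c.sqrtΔ r (x * r ^ 3) *
          (c.Y r (x * r ^ 3) - c.u r (x * r ^ 3))) :
    c.LocallyNaked := by
  have hα := c.α_pos
  have hx0 : 0 < x := hα.trans hx
  obtain ⟨p, hp, δ₁, hδ₁, hG⟩ := c.exists_cubic_le_G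
  obtain ⟨δ₂, hδ₂, hΨ⟩ := c.exists_Ψ_lipschitz
  obtain ⟨T, hT0, hTr₁, hTδ₁, hTδ₂, hT1, hTx⟩ : ∃ T > 0, T ≤ r₁ ∧ T ≤ δ₁ ∧ T < δ₂ ∧ T ≤ 1 ∧
      x * T < 1 := by
    refine ⟨min (min r₁ δ₁) (min (min (δ₂ / 2) 1) (1 / (2 * x))), ?_, ?_, ?_, ?_, ?_, ?_⟩
    · have := hr₁.1
      positivity
    · exact (min_le_left _ _).trans (min_le_left _ _)
    · exact (min_le_left _ _).trans (min_le_right _ _)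
    · exact lt_of_le_of_lt ((min_le_right _ _).trans ((min_le_left _ _).trans (min_le_left _ _)))
        (half_lt_self hδ₂)
    · exact (min_le_right _ _).trans ((min_le_left _ _).trans (min_le_right _ _))
    · calc x * _ ≤ x * (1 / (2 * x)) := by
            gcongr
            exact (min_le_right _ _).trans (min_le_right _ _)
        _ = 1 / 2 := by field_simp
        _ < 1 := by norm_num
  have hTr : T ≤ c.r₀ := hTr₁.trans hr₁.2
  have hG' : ∀ t ∈ Ioc 0 T, ∀ R ∈ Icc 0 t, p * t ^ 3 ≤ c.G t R := fun t ht R hR =>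
    hG t ⟨ht.1, le_min (ht.2.trans hTδ₁) (ht.2.trans hTr)⟩ R hR
  have hxt : ∀ t ∈ Ioc 0 T, x * t ^ 3 < t := by
    intro t ht
    have h1 : x * t ≤ x * T := by have := ht.2; gcongr
    calc x * t ^ 3 = x * t * t ^ 2 := by ring
      _ < 1 * t ^ 2 := mul_lt_mul_of_pos_right (by linarith) (pow_pos ht.1 2)
      _ ≤ t := by nlinarith [ht.1, ht.2]
  have hlow : ∀ t ∈ Ioc 0 T, min p (x / 2) * t ^ 3 ≤ 2 * c.Ψ t 0 := by
    intro t ht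
    have h1 := hG' t ht 0 ⟨le_rfl, ht.1.le⟩
    have h2 : min p (x / 2) * t ^ 3 ≤ p * t ^ 3 :=
      mul_le_mul_of_nonneg_right (min_le_left _ _) (pow_pos ht.1 3).le
    simp only [ARSData.G, zero_mul, add_zero] at h1
    exact h2.trans h1
  obtain ⟨f, hf⟩ := c.exists_geodesic_le_cubic (b := min p (x / 2)) (x := x) (T := T)
    (by positivity) ((min_le_right _ _).trans_lt (half_lt_self hx0)) ⟨hT0, hTr⟩
    (by nlinarith) hlow (fun t ht => hsub t ⟨ht.1, ht.2.trans hTr₁⟩)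
  have hT2 : ∀ t ∈ Ioc 0 (T / 2), t ∈ Ioo 0 T := fun t ht => ⟨ht.1, by linarith [ht.2]⟩
  have hev : ∀ᶠ t in 𝓝[>] (0 : ℝ), t ∈ Ioo 0 T := Ioo_mem_nhdsGT hT0
  have hcubic : Tendsto (fun t : ℝ => x * t ^ 3) (𝓝[>] 0) (𝓝 0) := by
    have : Continuous fun t : ℝ => x * t ^ 3 := by fun_prop
    simpa using (this.tendsto 0).mono_left nhdsWithin_le_nhds
  have hf0 : Tendsto f (𝓝[>] 0) (𝓝 0) := by
    refine tendsto_of_tendsto_of_tendsto_of_le_of_le' tendsto_const_nhds hcubic ?_ ?_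
    · filter_upwards [hev] with t ht using (hf t ht).2.1.le
    · filter_upwards [hev] with t ht using (hf t ht).2.2.1
  refine ⟨T / 2, ⟨by positivity, by linarith⟩, f, fun t ht => (hf t (hT2 t ht)).1,
    fun t ht => ?_, hf0, ?_⟩
  · obtain ⟨-, h0, h1, h2⟩ := hf t (hT2 t ht)
    have htT : t ∈ Ioc 0 T := Ioo_subset_Ioc_self (hT2 t ht)
    have hlt : f t < t := h1.trans_lt (hxt t htT)
    refine ⟨?_, hlt⟩
    by_contra! hle
    have htr : t ∈ Ioc 0 c.r₀ := ⟨htT.1, htT.2.trans hTr⟩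
    have hRh := c.Rh_lt t htr
    have h3 := (abs_le.1 (hΨ t ⟨htT.1.le, by linarith [htT.2]⟩ (c.Rh t)
      ⟨(c.Rh_pos t htr).le, by linarith [htT.2]⟩ (f t) ⟨h0.le, by linarith [htT.2]⟩)).2
    rw [abs_of_nonneg (by linarith)] at h3
    linarith [c.Rh_eq t htr]
  · refine squeeze_zero_norm' (a := fun t => √(x / p) * |f t - 0|) ?_ ?_
    · filter_upwards [hev] with t ht
      obtain ⟨-, h0, h1, -⟩ := hf t ht
      refine intervalIntegral.norm_integral_le_of_norm_le_const fun σ hσ => ?_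
      rw [uIoc_of_le h0.le] at hσ
      have htT : t ∈ Ioc 0 T := Ioo_subset_Ioc_self ht
      have h2 := hG' t htT σ ⟨hσ.1.le, hσ.2.trans (h1.trans (hxt t htT).le)⟩
      have h3 : 0 < p * t ^ 3 := mul_pos hp (pow_pos ht.1 3)
      rw [Real.norm_eq_abs, ARSData.H, abs_of_nonneg (Real.sqrt_nonneg _)]
      refine Real.sqrt_le_sqrt ?_
      calc σ / c.G t σ ≤ (x * t ^ 3) / (p * t ^ 3) :=
            div_le_div₀ (by have := ht.1; positivity) (hσ.2.trans h1) h3 h2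
        _ = x / p := by
            have := ht.1.ne'
            field_simp
    · simpa using (hf0.abs.const_mul √(x / p))
end
end

section
/- In a collapsing ARS model, the center becomes trapped at the same comoving time at which it becomes singular: lim_{r→0⁺} ∫₀^{R_h(r)} H(r,σ) dσ = 0 (so that the difference t_s(r) − t_h(r) between the singularity time and the horizon time of the shell r tends to 0 as r → 0⁺). -/
noncomputable section

open Real Set Filter Topology Asymptotics MeasureTheory intervalIntegral

/-- An ARS spacetime together with its apparent horizon `R_h`,
satisfying `0 < R_h(r) < r` and `R_h(r) = 2Ψ(r, R_h(r))` on `(0, r₀]`. -/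
structure ARSWithHorizon extends ARSData where
  Rh : ℝ → ℝ
  Rh_pos : ∀ r ∈ Ioc (0:ℝ) r₀, 0 < Rh r
  Rh_lt : ∀ r ∈ Ioc (0:ℝ) r₀, Rh r < r
  Rh_eq : ∀ r ∈ Ioc (0:ℝ) r₀, Rh r = 2 * Ψ r (Rh r)

namespace ARSData

/-- A property holding near the origin of the coordinate square holds on all sufficiently
small triangles `0 ≤ R ≤ r`. -/
lemma eventually_forall_Icc_of_eventually {r₀ : ℝ} (hr₀ : 0 < r₀) {p : ℝ × ℝ → Prop}
    (h : ∀ᶠ x in 𝓝[Icc (0:ℝ) r₀ ×ˢ Icc (0:ℝ) r₀] ((0 : ℝ), (0 : ℝ)), p x) :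
    ∀ᶠ r in 𝓝[>] (0:ℝ), ∀ R ∈ Icc 0 r, p (r, R) := by
  obtain ⟨δ, hδ, hball⟩ := Metric.mem_nhdsWithin_iff.1 h
  filter_upwards [Ioo_mem_nhdsGT (lt_min hδ hr₀)] with r hr R hR
  have hrδ : r < δ := hr.2.trans_le (min_le_left _ _)
  have hrr : r < r₀ := hr.2.trans_le (min_le_right _ _)
  refine hball ⟨?_, ⟨hr.1.le, hrr.le⟩, ⟨hR.1, hR.2.trans hrr.le⟩⟩
  rw [Metric.mem_ball, Prod.dist_eq, max_lt_iff, Real.dist_0_eq_abs, Real.dist_0_eq_abs,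
    abs_of_pos hr.1, abs_of_nonneg hR.1]
  exact ⟨hrδ, hR.2.trans_lt hrδ⟩

/-- On the triangle `0 ≤ R ≤ r`, the function `G` is comparable to `r ^ 3` near the origin. -/
lemma exists_G_bounds (a : ARSData) :
    ∃ m M : ℝ, 0 < m ∧ 0 < M ∧ ∀ᶠ r in 𝓝[>] (0:ℝ), ∀ R ∈ Icc 0 r,
      m * r ^ 3 ≤ a.G r R ∧ a.G r R ≤ M * r ^ 3 := by
  have hcont : ContinuousOn a.P (Icc 0 1) := by
    unfold ARSData.P
    fun_prop
  have hne : (Icc (0:ℝ) 1).Nonempty := nonempty_Icc.2 zero_le_one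
  obtain ⟨s, hs, hmin⟩ := isCompact_Icc.exists_isMinOn hne hcont
  obtain ⟨t, ht, hmax⟩ := isCompact_Icc.exists_isMaxOn hne hcont
  have hsP : 0 < a.P s := a.P_pos s hs
  have htP : 0 < a.P t := a.P_pos t ht
  refine ⟨a.P s / 2, a.P t + a.P s / 2, by linarith, by linarith, ?_⟩
  have hT := eventually_forall_Icc_of_eventually a.r₀_pos
    (a.taylor.bound (show 0 < a.P s / 16 by linarith))
  filter_upwards [hT, self_mem_nhdsWithin] with r hr hr0 R hR
  have hrpos : 0 < r := hr0
  have h := hr R hR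
  simp only [Real.norm_eq_abs] at h
  have hτ : R / r ∈ Icc (0:ℝ) 1 := ⟨div_nonneg hR.1 hrpos.le, (div_le_one hrpos).2 hR.2⟩
  have hpoly : a.h30 * r ^ 3 + a.h21 * r ^ 2 * R + a.h12 * r * R ^ 2 + a.h03 * R ^ 3
      = a.P (R / r) * r ^ 3 := by
    unfold ARSData.P
    field_simp
  have hr3 : 0 < r ^ 3 := pow_pos hrpos 3
  have hlow : a.P s * r ^ 3 ≤ a.P (R / r) * r ^ 3 :=
    mul_le_mul_of_nonneg_right (hmin hτ) hr3.le
  have hupp : a.P (R / r) * r ^ 3 ≤ a.P t * r ^ 3 :=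
    mul_le_mul_of_nonneg_right (hmax hτ) hr3.le
  have hsum : 0 ≤ r + R := add_nonneg hrpos.le hR.1
  have hpow : (r + R) ^ 3 ≤ 8 * r ^ 3 := by
    calc (r + R) ^ 3 ≤ (2 * r) ^ 3 := pow_le_pow_left₀ hsum (by linarith [hR.2]) 3
      _ = 8 * r ^ 3 := by ring
  rw [abs_of_nonneg (pow_nonneg hsum 3), hpoly] at h
  have herr : a.P s / 16 * (r + R) ^ 3 ≤ a.P s / 2 * r ^ 3 := by
    calc a.P s / 16 * (r + R) ^ 3 ≤ a.P s / 16 * (8 * r ^ 3) := by gcongr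
      _ = a.P s / 2 * r ^ 3 := by ring
  obtain ⟨h₁, h₂⟩ := abs_le.1 h
  unfold ARSData.G
  constructor <;> linarith

lemma eventually_half_lt_Y (a : ARSData) :
    ∀ᶠ r in 𝓝[>] (0:ℝ), ∀ R ∈ Icc 0 r, 1 / 2 < a.Y r R := by
  obtain ⟨U, hU, hsub, -, hY⟩ := a.smooth
  have h0 : ((0 : ℝ), (0 : ℝ)) ∈ U :=
    hsub ⟨left_mem_Icc.2 a.r₀_pos.le, left_mem_Icc.2 a.r₀_pos.le⟩
  have hc := hY.continuousOn.continuousAt (hU.mem_nhds h0)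
  refine eventually_forall_Icc_of_eventually (p := fun x => 1 / 2 < a.Y x.1 x.2) a.r₀_pos
    (nhdsWithin_le_nhds (hc.eventually_const_lt ?_))
  norm_num [a.Y_origin]

end ARSData

/-- Near the center, the apparent horizon satisfies `R_h(r) = O(r ^ 3)`. -/
lemma ARSWithHorizon.eventually_Rh_le (c : ARSWithHorizon) {M : ℝ}
    (hG : ∀ᶠ r in 𝓝[>] (0:ℝ), ∀ R ∈ Icc 0 r, c.G r R ≤ M * r ^ 3) :
    ∀ᶠ r in 𝓝[>] (0:ℝ), c.Rh r ≤ 4 * M * r ^ 3 := by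
  filter_upwards [hG, c.eventually_half_lt_Y, Ioo_mem_nhdsGT c.r₀_pos] with r hGr hY hr
  have hmem : r ∈ Ioc 0 c.r₀ := ⟨hr.1, hr.2.le⟩
  have hRh := c.Rh_pos r hmem
  have hIcc : c.Rh r ∈ Icc 0 r := ⟨hRh.le, (c.Rh_lt r hmem).le⟩
  have hle := hGr _ hIcc
  have hYsq : 1 / 4 ≤ c.Y r (c.Rh r) ^ 2 := by nlinarith [hY _ hIcc]
  have hmul : c.Rh r * (1 / 4) ≤ c.Rh r * c.Y r (c.Rh r) ^ 2 :=
    mul_le_mul_of_nonneg_left hYsq hRh.le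
  have heq := c.Rh_eq r hmem
  unfold ARSData.G at hle
  linarith

/-- **Proposition (the center is trapped when it becomes singular).** In a collapsing
ARS model, `∫₀^{R_h(r)} H(r,σ) dσ → 0` as `r → 0⁺`, i.e. the difference between the
singularity time and the horizon time of the shell `r` tends to `0` as `r → 0⁺`. -/
theorem center_trapped_at_singular_time (c : ARSWithHorizon) :
    Tendsto (fun r => ∫ σ in (0:ℝ)..(c.Rh r), c.H r σ) (𝓝[>] 0) (𝓝 0) := by
  obtain ⟨m, M, hm, hM, hG⟩ := c.exists_G_bounds
  have hlim : Tendsto (fun r : ℝ => √(4 * M / m) * (4 * M * r ^ 3)) (𝓝[>] 0) (𝓝 0) := by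
    have : Continuous fun r : ℝ => √(4 * M / m) * (4 * M * r ^ 3) := by fun_prop
    simpa using (this.tendsto 0).mono_left nhdsWithin_le_nhds
  refine squeeze_zero_norm' ?_ hlim
  filter_upwards [hG, c.eventually_Rh_le (hG.mono fun r h R hR => (h R hR).2),
    Ioo_mem_nhdsGT c.r₀_pos] with r hGr hle hr
  have hmem : r ∈ Ioc 0 c.r₀ := ⟨hr.1, hr.2.le⟩
  have hRh := c.Rh_pos r hmem
  have hr3 : 0 < r ^ 3 := pow_pos hr.1 3
  have hH : ∀ σ ∈ uIoc 0 (c.Rh r), ‖c.H r σ‖ ≤ √(4 * M / m) := by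
    intro σ hσ
    rw [uIoc_of_le hRh.le] at hσ
    have hlow := (hGr σ ⟨hσ.1.le, hσ.2.trans (c.Rh_lt r hmem).le⟩).1
    unfold ARSData.H
    rw [Real.norm_of_nonneg (Real.sqrt_nonneg _)]
    refine Real.sqrt_le_sqrt ?_
    calc σ / c.G r σ ≤ 4 * M * r ^ 3 / (m * r ^ 3) :=
          div_le_div₀ (by positivity) (hσ.2.trans hle) (by positivity) hlow
      _ = 4 * M / m := mul_div_mul_right _ _ hr3.ne'
  calc ‖∫ σ in (0:ℝ)..(c.Rh r), c.H r σ‖ ≤ √(4 * M / m) * |c.Rh r - 0| :=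
        norm_integral_le_of_norm_le_const hH
    _ ≤ √(4 * M / m) * (4 * M * r ^ 3) := by
        rw [sub_zero, abs_of_pos hRh]
        gcongr
end
end

section
/- In a collapsing ARS model, a shell-focusing singularity forms at the center in a finite positive amount of comoving time: the limit lim_{r→0⁺} ∫₀^r H(r,σ) dσ exists, is finite and strictly positive, and equals ∫₀¹ √(τ/P(τ)) dτ. -/
noncomputable section

open Real Set Filter Topology Asymptotics MeasureTheory intervalIntegral

namespace ARSData

lemma continuous_P (a : ARSData) : Continuous a.P := by
  unfold P; fun_prop

lemma continuousOn_G (a : ARSData) {r : ℝ} (hr : r ∈ Icc 0 a.r₀) :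
    ContinuousOn (a.G r) (Icc 0 a.r₀) := by
  obtain ⟨U, -, hU, hΨ, hY⟩ := a.smooth
  have hmaps : MapsTo (fun R : ℝ => (r, R)) (Icc 0 a.r₀) U := fun R hR => hU ⟨hr, hR⟩
  have hpair : ContinuousOn (fun R : ℝ => (r, R)) (Icc 0 a.r₀) := by fun_prop
  have hΨ' : ContinuousOn (fun R => a.Ψ r R) (Icc 0 a.r₀) := hΨ.continuousOn.comp hpair hmaps
  have hY' : ContinuousOn (fun R => a.Y r R) (Icc 0 a.r₀) := hY.continuousOn.comp hpair hmaps
  unfold G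
  fun_prop

/-- `G(r, rτ) / r³` converges to `P(τ)` as `r → 0⁺`, uniformly in `τ ∈ [0,1]`. -/
lemma eventually_abs_rescaled_G_sub_P_le (a : ARSData) {ε : ℝ} (hε : 0 < ε) :
    ∀ᶠ r in 𝓝[>] (0:ℝ), ∀ τ ∈ Icc (0:ℝ) 1, |a.G r (r * τ) / r ^ 3 - a.P τ| ≤ ε := by
  have htaylor := a.taylor.bound (show 0 < ε / 8 by positivity)
  rw [eventually_nhdsWithin_iff, Metric.eventually_nhds_iff] at htaylor
  obtain ⟨δ, hδ, hbound⟩ := htaylor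
  filter_upwards [Ioo_mem_nhdsGT (lt_min hδ a.r₀_pos)] with r hr τ hτ
  obtain ⟨hr0, hr1⟩ := hr
  obtain ⟨hrδ, hrr⟩ := lt_min_iff.1 hr1
  have hrτ0 : 0 ≤ r * τ := mul_nonneg hr0.le hτ.1
  have hrτ : r * τ ≤ r := mul_le_of_le_one_right hr0.le hτ.2
  have h := @hbound (r, r * τ)
    (by
      rw [Prod.dist_eq, Real.dist_eq, Real.dist_eq, sub_zero, sub_zero, abs_of_pos hr0,
        abs_of_nonneg hrτ0]
      exact max_lt hrδ (hrτ.trans_lt hrδ))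
    ⟨⟨hr0.le, hrr.le⟩, hrτ0, hrτ.trans hrr.le⟩
  simp only [Real.norm_eq_abs] at h
  have hsum : |(r + r * τ) ^ 3| ≤ 8 * r ^ 3 := by
    rw [abs_of_nonneg (by positivity)]
    calc (r + r * τ) ^ 3 ≤ (2 * r) ^ 3 := by gcongr; linarith
      _ = 8 * r ^ 3 := by ring
  have hr3 : 0 < r ^ 3 := by positivity
  have hrescale : a.G r (r * τ) / r ^ 3 - a.P τ =
      (2 * a.Ψ r (r * τ) + r * τ * ((a.Y r (r * τ)) ^ 2 - 1) -
        (a.h30 * r ^ 3 + a.h21 * r ^ 2 * (r * τ) + a.h12 * r * (r * τ) ^ 2 +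
          a.h03 * (r * τ) ^ 3)) / r ^ 3 := by
    unfold G P
    field_simp
  rw [hrescale, abs_div, abs_of_pos hr3, div_le_iff₀ hr3]
  calc _ ≤ ε / 8 * |(r + r * τ) ^ 3| := h
    _ ≤ ε / 8 * (8 * r ^ 3) := by gcongr
    _ = ε * r ^ 3 := by ring

lemma tendsto_rescaled_G (a : ARSData) {τ : ℝ} (hτ : τ ∈ Icc (0:ℝ) 1) :
    Tendsto (fun r => a.G r (r * τ) / r ^ 3) (𝓝[>] 0) (𝓝 (a.P τ)) := by
  rw [Metric.tendsto_nhds]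
  intro ε hε
  filter_upwards [a.eventually_abs_rescaled_G_sub_P_le (half_pos hε)] with r hr
  rw [Real.dist_eq]
  exact (hr τ hτ).trans_lt (half_lt_self hε)

lemma exists_pos_forall_le_P (a : ARSData) : ∃ m > 0, ∀ τ ∈ Icc (0:ℝ) 1, m ≤ a.P τ := by
  obtain ⟨τ₀, hτ₀, hmin⟩ :=
    isCompact_Icc.exists_isMinOn (nonempty_Icc.2 zero_le_one) a.continuous_P.continuousOn
  exact ⟨a.P τ₀, a.P_pos τ₀ hτ₀, hmin⟩

lemma mul_H_rescaled (a : ARSData) {r : ℝ} (hr : 0 < r) (τ : ℝ) :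
    r * a.H r (r * τ) = √(τ / (a.G r (r * τ) / r ^ 3)) := by
  have h : τ / (a.G r (r * τ) / r ^ 3) = r ^ 2 * (r * τ / a.G r (r * τ)) := by
    rw [div_div_eq_mul_div]
    ring
  rw [h, Real.sqrt_mul (sq_nonneg r), Real.sqrt_sq hr.le, H]

lemma integral_H_eq (a : ARSData) {r : ℝ} (hr : 0 < r) :
    ∫ σ in (0:ℝ)..r, a.H r σ = ∫ τ in (0:ℝ)..1, √(τ / (a.G r (r * τ) / r ^ 3)) := by
  simp_rw [← a.mul_H_rescaled hr]
  rw [intervalIntegral.integral_const_mul, intervalIntegral.mul_integral_comp_mul_left]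
  simp

lemma aestronglyMeasurable_rescaled_H (a : ARSData) {r : ℝ} (hr : r ∈ Ioc 0 a.r₀) :
    AEStronglyMeasurable (fun τ => √(τ / (a.G r (r * τ) / r ^ 3)))
      (volume.restrict (uIoc (0:ℝ) 1)) := by
  rw [uIoc_of_le zero_le_one]
  have hcont : ContinuousOn (fun τ => a.G r (r * τ)) (Ioc 0 1) :=
    (a.continuousOn_G ⟨hr.1.le, hr.2⟩).comp (by fun_prop) fun τ hτ =>
      ⟨mul_nonneg hr.1.le hτ.1.le, (mul_le_of_le_one_right hr.1.le hτ.2).trans hr.2⟩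
  have hmeas := hcont.aemeasurable (μ := volume) measurableSet_Ioc
  exact (aemeasurable_id.div (hmeas.div_const (r ^ 3))).sqrt.aestronglyMeasurable

lemma integral_sqrt_div_P_pos (a : ARSData) : 0 < ∫ τ in (0:ℝ)..1, √(τ / a.P τ) := by
  have hcont : ContinuousOn (fun τ => √(τ / a.P τ)) (Icc 0 1) :=
    (continuousOn_id.div a.continuous_P.continuousOn fun τ hτ => (a.P_pos τ hτ).ne').sqrt
  refine intervalIntegral.intervalIntegral_pos_of_pos_on
    (hcont.intervalIntegrable_of_Icc zero_le_one) (fun τ hτ => ?_) one_pos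
  exact Real.sqrt_pos.2 (div_pos hτ.1 (a.P_pos τ ⟨hτ.1.le, hτ.2.le⟩))

lemma tendsto_integral_H (a : ARSData) :
    Tendsto (fun r => ∫ σ in (0:ℝ)..r, a.H r σ) (𝓝[>] 0)
      (𝓝 (∫ τ in (0:ℝ)..1, √(τ / a.P τ))) := by
  obtain ⟨m, hm, hmP⟩ := a.exists_pos_forall_le_P
  have hlim : Tendsto (fun r => ∫ τ in (0:ℝ)..1, √(τ / (a.G r (r * τ) / r ^ 3))) (𝓝[>] 0)
      (𝓝 (∫ τ in (0:ℝ)..1, √(τ / a.P τ))) := by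
    refine intervalIntegral.tendsto_integral_filter_of_dominated_convergence
      (fun _ => √(1 / (m / 2))) ?_ ?_ intervalIntegrable_const ?_
    · filter_upwards [Ioc_mem_nhdsGT a.r₀_pos] with r hr
      exact a.aestronglyMeasurable_rescaled_H hr
    · filter_upwards [a.eventually_abs_rescaled_G_sub_P_le (half_pos hm)] with r hr
      refine ae_of_all _ fun τ hτ => ?_
      rw [uIoc_of_le zero_le_one] at hτ
      have hτ' := Ioc_subset_Icc_self hτ
      have hlower : m / 2 ≤ a.G r (r * τ) / r ^ 3 := by
        linarith [(abs_le.1 (hr τ hτ')).1, hmP τ hτ']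
      rw [Real.norm_of_nonneg (Real.sqrt_nonneg _)]
      exact Real.sqrt_le_sqrt (div_le_div₀ zero_le_one hτ.2 (half_pos hm) hlower)
    · refine ae_of_all _ fun τ hτ => ?_
      rw [uIoc_of_le zero_le_one] at hτ
      have hτ' := Ioc_subset_Icc_self hτ
      exact (tendsto_const_nhds.div (a.tendsto_rescaled_G hτ') (a.P_pos τ hτ').ne').sqrt
  refine hlim.congr' ?_
  filter_upwards [self_mem_nhdsWithin] with r hr
  exact (a.integral_H_eq hr).symm

end ARSData

/-- **Proposition (shell-focusing singularity formation).** In a collapsing ARS model,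
the central shell-focusing singularity forms in a finite positive amount of comoving
time: `∫₀^r H(r,σ) dσ` converges, as `r → 0⁺`, to the finite strictly positive value
`∫₀¹ √(τ/P(τ)) dτ`. -/
theorem shellFocusing_singularity_forms (a : ARSData) :
    0 < (∫ τ in (0:ℝ)..1, Real.sqrt (τ / a.P τ)) ∧
    Tendsto (fun r => ∫ σ in (0:ℝ)..r, a.H r σ) (𝓝[>] 0)
      (𝓝 (∫ τ in (0:ℝ)..1, Real.sqrt (τ / a.P τ))) :=
  ⟨a.integral_sqrt_div_P_pos, a.tendsto_integral_H⟩
end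
end

section
/- In a collapsing ARS model, for every fixed x > 0 the following asymptotics hold along the curve R = x r³: lim_{r→0⁺} u(r, x r³) = √(α/x), lim_{r→0⁺} Y(r, x r³) = 1, and lim_{r→0⁺} (√Δ(r, x r³) − √Δ(r,0))/r² = x^{3/2}/√α. -/
noncomputable section

open Real Set Filter Topology Asymptotics MeasureTheory intervalIntegral

/-- If `φ` vanishes to second order at `0` and `φ(s)/s³ → c` as `s → 0⁺`, then
`φ'(s)/s² → 3c`. -/
theorem tendsto_deriv_div_sq_of_tendsto_div_cube {φ : ℝ → ℝ} {c : ℝ}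
    (hφ : ContDiffAt ℝ 3 φ 0) (h0 : φ 0 = 0) (h1 : deriv φ 0 = 0)
    (h2 : deriv (deriv φ) 0 = 0)
    (hc : Tendsto (fun s => φ s / s ^ 3) (𝓝[>] 0) (𝓝 c)) :
    Tendsto (fun s => deriv φ s / s ^ 2) (𝓝[>] 0) (𝓝 (3 * c)) := by
  have d1 : ContDiffAt ℝ 2 (deriv φ) 0 := by
    have := hφ.derivWithin (m := 2) (by norm_num)
    simpa using this
  have d2 : ContDiffAt ℝ 1 (deriv (deriv φ)) 0 := by
    have := d1.derivWithin (m := 1) (by norm_num)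
    simpa using this
  have e0 : ∀ᶠ s in 𝓝[>] (0 : ℝ), HasDerivAt φ (deriv φ s) s := by
    refine nhdsWithin_le_nhds ?_
    filter_upwards [hφ.eventually (by simp)] with s hs
    exact (hs.differentiableAt (by simp)).hasDerivAt
  have e1 : ∀ᶠ s in 𝓝[>] (0 : ℝ), HasDerivAt (deriv φ) (deriv (deriv φ) s) s := by
    refine nhdsWithin_le_nhds ?_
    filter_upwards [d1.eventually (by simp)] with s hs
    exact (hs.differentiableAt (by simp)).hasDerivAt
  have pos : ∀ᶠ s : ℝ in 𝓝[>] 0, 0 < s := self_mem_nhdsWithin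
  have z0 : Tendsto φ (𝓝[>] 0) (𝓝 0) := by
    simpa [h0] using hφ.continuousAt.tendsto.mono_left nhdsWithin_le_nhds
  have z1 : Tendsto (deriv φ) (𝓝[>] 0) (𝓝 0) := by
    simpa [h1] using d1.continuousAt.tendsto.mono_left nhdsWithin_le_nhds
  have zpow : ∀ k : ℕ, k ≠ 0 → Tendsto (fun s : ℝ => s ^ k) (𝓝[>] 0) (𝓝 0) := by
    intro k hk
    have : Tendsto (fun s : ℝ => s ^ k) (𝓝 0) (𝓝 (0 ^ k)) := (continuous_pow k).tendsto 0
    rw [zero_pow hk] at this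
    exact this.mono_left nhdsWithin_le_nhds
  set d := deriv (deriv (deriv φ)) 0 with hd
  have l2 : Tendsto (fun s => deriv (deriv φ) s / s) (𝓝[>] 0) (𝓝 d) := by
    have := (d2.differentiableAt (by simp)).hasDerivAt.tendsto_slope_zero_right
    simpa [h2, div_eq_inv_mul] using this
  have l1 : Tendsto (fun s => deriv φ s / s ^ 2) (𝓝[>] 0) (𝓝 (d / 2)) := by
    refine HasDerivAt.lhopital_zero_nhdsGT (g' := fun s => 2 * s) e1
      (Eventually.of_forall fun s => by simpa using hasDerivAt_pow 2 s) ?_ z1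
      (zpow 2 (by norm_num)) ?_
    · filter_upwards [pos] with s hs
      positivity
    · refine (l2.div_const 2).congr' ?_
      filter_upwards [pos] with s hs
      field_simp
  have l0 : Tendsto (fun s => φ s / s ^ 3) (𝓝[>] 0) (𝓝 (d / 2 / 3)) := by
    refine HasDerivAt.lhopital_zero_nhdsGT (g' := fun s => 3 * s ^ 2) e0
      (Eventually.of_forall fun s => by simpa using hasDerivAt_pow 3 s) ?_ z0
      (zpow 3 (by norm_num)) ?_
    · filter_upwards [pos] with s hs
      positivity
    · refine (l1.div_const 3).congr' ?_
      filter_upwards [pos] with s hs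
      field_simp
  rw [tendsto_nhds_unique hc l0]
  convert l1 using 2
  ring

theorem integral_sqrt_zero_left (x : ℝ) :
    ∫ t in (0 : ℝ)..x, √t = 2 / 3 * x ^ ((3 : ℝ) / 2) := by
  simp_rw [Real.sqrt_eq_rpow]
  rw [integral_rpow (Or.inl (by norm_num)), Real.zero_rpow (by norm_num)]
  norm_num
  ring

namespace ARSData

variable (a : ARSData)

theorem exists_contDiffOn : ∃ U : Set (ℝ × ℝ), IsOpen U ∧ Icc 0 a.r₀ ×ˢ Icc 0 a.r₀ ⊆ U ∧
    ContDiffOn ℝ (⊤ : ℕ∞) (fun p : ℝ × ℝ => a.G p.1 p.2) U := by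
  obtain ⟨U, hU, hsub, hΨ, hY⟩ := a.smooth
  refine ⟨U, hU, hsub, ?_⟩
  unfold G
  exact (contDiffOn_const.mul hΨ).add (contDiffOn_snd.mul ((hY.pow 2).sub contDiffOn_const))

theorem contDiffAt_G {r R : ℝ} (hr : r ∈ Icc 0 a.r₀) (hR : R ∈ Icc 0 a.r₀) :
    ContDiffAt ℝ (⊤ : ℕ∞) (fun p : ℝ × ℝ => a.G p.1 p.2) (r, R) := by
  obtain ⟨U, hU, hsub, hG⟩ := a.exists_contDiffOn
  exact hG.contDiffAt (hU.mem_nhds (hsub ⟨hr, hR⟩))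

theorem contDiffAt_Y {r R : ℝ} (hr : r ∈ Icc 0 a.r₀) (hR : R ∈ Icc 0 a.r₀) :
    ContDiffAt ℝ (⊤ : ℕ∞) (fun p : ℝ × ℝ => a.Y p.1 p.2) (r, R) := by
  obtain ⟨U, hU, hsub, -, hY⟩ := a.smooth
  exact hY.contDiffAt (hU.mem_nhds (hsub ⟨hr, hR⟩))

theorem zero_mem_Icc : (0 : ℝ) ∈ Icc 0 a.r₀ := ⟨le_rfl, a.r₀_pos.le⟩

/-- The radial derivative `∂G/∂r`. -/
def Gr (p : ℝ × ℝ) : ℝ := fderiv ℝ (fun p : ℝ × ℝ => a.G p.1 p.2) p (1, 0)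

theorem contDiffAt_Gr {r R : ℝ} (hr : r ∈ Icc 0 a.r₀) (hR : R ∈ Icc 0 a.r₀) :
    ContDiffAt ℝ 1 a.Gr (r, R) :=
  ((a.contDiffAt_G hr hR).fderiv_right (m := 1) (by norm_cast)).clm_apply contDiffAt_const

theorem hasDerivAt_G {r R : ℝ} (hr : r ∈ Icc 0 a.r₀) (hR : R ∈ Icc 0 a.r₀) :
    HasDerivAt (fun s => a.G s R) (a.Gr (r, R)) r :=
  ((a.contDiffAt_G hr hR).differentiableAt (by simp)).hasFDerivAt.comp_hasDerivAt r
    (f := fun s : ℝ => (s, R)) ((hasDerivAt_id r).prodMk (hasDerivAt_const r R))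

theorem deriv_H {r R : ℝ} (hr : r ∈ Icc 0 a.r₀) (hR : R ∈ Icc 0 a.r₀) (hG : 0 < a.G r R) :
    deriv (fun s => a.H s R) r = -(1 / 2) * √R * a.Gr (r, R) / (a.G r R * √(a.G r R)) := by
  rcases hR.1.eq_or_lt with rfl | hpos
  · simp [H]
  · have h := (((hasDerivAt_const r R).div (a.hasDerivAt_G hr hR) hG.ne').sqrt
      (div_pos hpos hG).ne').deriv
    have e : (fun s => a.H s R) = fun s => √(((fun _ => R) / fun s' => a.G s' R : ℝ → ℝ) s) := rfl
    rw [e, h]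
    have h1 : 0 < √R := Real.sqrt_pos.2 hpos
    have h2 : 0 < √(a.G r R) := Real.sqrt_pos.2 hG
    have h3 : √R ^ 2 = R := Real.sq_sqrt hpos.le
    have h4 : √(a.G r R) ^ 2 = a.G r R := Real.sq_sqrt hG.le
    simp only [Pi.div_apply]
    rw [Real.sqrt_div hpos.le]
    generalize √(a.G r R) = g at *
    generalize √R = q at *
    rw [← h4, ← h3]
    field_simp
    ring

theorem continuousOn_integrand {r : ℝ} (hr : r ∈ Icc 0 a.r₀)
    (hG : ∀ σ ∈ Icc 0 r, 0 < a.G r σ) :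
    ContinuousOn (fun σ => (a.Y r σ)⁻¹ * deriv (fun s => a.H s σ) r) (Icc 0 r) := by
  have hmem : ∀ σ ∈ Icc 0 r, σ ∈ Icc 0 a.r₀ := fun σ hσ => ⟨hσ.1, hσ.2.trans hr.2⟩
  have cp : ∀ σ : ℝ, ContinuousAt (fun σ : ℝ => (r, σ)) σ := fun σ => by fun_prop
  have cG : ContinuousOn (fun σ => a.G r σ) (Icc 0 r) := fun σ hσ =>
    ((a.contDiffAt_G hr (hmem σ hσ)).continuousAt.comp (cp σ)).continuousWithinAt
  have cGr : ContinuousOn (fun σ => a.Gr (r, σ)) (Icc 0 r) := fun σ hσ =>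
    ((a.contDiffAt_Gr hr (hmem σ hσ)).continuousAt.comp (cp σ)).continuousWithinAt
  have cY : ContinuousOn (fun σ => a.Y r σ) (Icc 0 r) := fun σ hσ =>
    ((a.contDiffAt_Y hr (hmem σ hσ)).continuousAt.comp (cp σ)).continuousWithinAt
  have key : ContinuousOn (fun σ => (a.Y r σ)⁻¹ *
      (-(1 / 2) * √σ * a.Gr (r, σ) / (a.G r σ * √(a.G r σ)))) (Icc 0 r) := by
    refine (cY.inv₀ fun σ hσ => (a.Y_pos r hr σ (hmem σ hσ)).ne').mul
      (((continuousOn_const.mul Real.continuous_sqrt.continuousOn).mul cGr).div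
        (cG.mul cG.sqrt) fun σ hσ => ?_)
    have := hG σ hσ
    positivity
  refine key.congr fun σ hσ => ?_
  simp only [a.deriv_H hr (hmem σ hσ) (hG σ hσ)]

/-- The filter of points `(r, t)` with `r → 0⁺`, uniformly in `t ∈ [0,x]`. -/
def cubicFilter (x : ℝ) : Filter (ℝ × ℝ) := 𝓝[>] 0 ×ˢ 𝓟 (Icc 0 x)

theorem tendsto_prodMk_cubicFilter {x t : ℝ} (ht : t ∈ Icc 0 x) :
    Tendsto (fun r : ℝ => (r, t)) (𝓝[>] 0) (cubicFilter x) :=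
  tendsto_id.prodMk (tendsto_principal.2 (Eventually.of_forall fun _ => ht))

theorem eventually_cubicFilter (x : ℝ) : ∀ᶠ q in cubicFilter x, 0 < q.1 ∧ q.2 ∈ Icc 0 x :=
  prod_mem_prod self_mem_nhdsWithin (mem_principal_self (Icc 0 x))

theorem tendsto_fst_cubicFilter (x : ℝ) : Tendsto Prod.fst (cubicFilter x) (𝓝 0) :=
  tendsto_fst.mono_right nhdsWithin_le_nhds

theorem tendsto_pow_mul_cubicFilter (x : ℝ) {k : ℕ} (hk : k ≠ 0) :
    Tendsto (fun q : ℝ × ℝ => q.1 ^ k * q.2) (cubicFilter x) (𝓝 0) := by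
  have h : Tendsto (fun q : ℝ × ℝ => q.1 ^ k * x) (cubicFilter x) (𝓝 0) := by
    simpa [hk] using ((tendsto_fst_cubicFilter x).pow k).mul_const x
  refine tendsto_of_tendsto_of_tendsto_of_le_of_le' tendsto_const_nhds h ?_ ?_
  · filter_upwards [eventually_cubicFilter x] with q hq
    have := hq.1
    have := hq.2.1
    positivity
  · filter_upwards [eventually_cubicFilter x] with q hq
    have := hq.1
    have := hq.2.2
    gcongr

theorem tendsto_curve (x : ℝ) :
    Tendsto (fun q : ℝ × ℝ => (q.1, q.1 ^ 3 * q.2)) (cubicFilter x) (𝓝 ((0 : ℝ), (0 : ℝ))) :=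
  (tendsto_fst_cubicFilter x).prodMk_nhds (tendsto_pow_mul_cubicFilter x (by norm_num))

theorem eventually_curve_mem (x : ℝ) :
    ∀ᶠ q in cubicFilter x, q.1 ∈ Icc 0 a.r₀ ∧ q.1 ^ 3 * q.2 ∈ Icc 0 a.r₀ := by
  filter_upwards [eventually_cubicFilter x,
    (tendsto_fst_cubicFilter x).eventually (eventually_le_nhds a.r₀_pos),
    (tendsto_pow_mul_cubicFilter x (k := 3) (by norm_num)).eventually
      (eventually_le_nhds a.r₀_pos)] with q hq h1 h2
  have := hq.1
  have := hq.2.1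
  exact ⟨⟨by positivity, h1⟩, ⟨by positivity, h2⟩⟩

theorem tendsto_Y_curve (x : ℝ) :
    Tendsto (fun q : ℝ × ℝ => a.Y q.1 (q.1 ^ 3 * q.2)) (cubicFilter x) (𝓝 1) := by
  have h := (a.contDiffAt_Y a.zero_mem_Icc a.zero_mem_Icc).continuousAt.tendsto
  simp only [a.Y_origin] at h
  exact h.comp (tendsto_curve x)

theorem tendsto_G_curve (x : ℝ) :
    Tendsto (fun q : ℝ × ℝ => a.G q.1 (q.1 ^ 3 * q.2) / q.1 ^ 3) (cubicFilter x)
      (𝓝 a.h30) := by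
  have hto : Tendsto (fun q : ℝ × ℝ => (q.1, q.1 ^ 3 * q.2)) (cubicFilter x)
      (𝓝[Icc (0:ℝ) a.r₀ ×ˢ Icc (0:ℝ) a.r₀] (0, 0)) := by
    refine tendsto_nhdsWithin_iff.2 ⟨tendsto_curve x, ?_⟩
    filter_upwards [a.eventually_curve_mem x] with q hq using hq
  have h2 := tendsto_pow_mul_cubicFilter x (k := 2) (by norm_num)
  have hb : (fun q : ℝ × ℝ => (q.1 + q.1 ^ 3 * q.2) ^ 3) =O[cubicFilter x]
      fun q => q.1 ^ 3 := by
    have h1 : (fun q : ℝ × ℝ => (1 + q.1 ^ 2 * q.2) ^ 3) =O[cubicFilter x]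
        fun _ => (1 : ℝ) := ((h2.const_add 1).pow 3).isBigO_one ℝ
    refine ((isBigO_refl (fun q : ℝ × ℝ => q.1 ^ 3) _).mul h1).congr (fun q => ?_) (fun q => ?_)
    · ring
    · ring
  have ho := ((a.taylor.comp_tendsto hto).trans_isBigO hb).tendsto_div_nhds_zero
  have hm : Tendsto (fun q : ℝ × ℝ => a.h30 + a.h21 * (q.1 ^ 2 * q.2)
      + a.h12 * (q.1 ^ 2 * q.2) ^ 2 + a.h03 * (q.1 ^ 2 * q.2) ^ 3) (cubicFilter x)
      (𝓝 a.h30) := by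
    simpa using ((((h2.const_mul a.h21).const_add a.h30).add ((h2.pow 2).const_mul a.h12)).add
      ((h2.pow 3).const_mul a.h03))
  have hsum := ho.add hm
  rw [zero_add] at hsum
  refine hsum.congr' ?_
  filter_upwards [eventually_cubicFilter x] with q hq
  have := hq.1
  simp only [Function.comp_apply, G]
  field_simp
  ring

theorem tendsto_Gr_axis :
    Tendsto (fun r : ℝ => a.Gr (r, 0) / r ^ 2) (𝓝[>] 0) (𝓝 (3 * a.h30)) := by
  have hφ : ContDiffAt ℝ 3 (fun s => a.G s 0) 0 := by
    have h : ContDiffAt ℝ 3 (fun p : ℝ × ℝ => a.G p.1 p.2) (0, 0) :=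
      (a.contDiffAt_G a.zero_mem_Icc a.zero_mem_Icc).of_le (by norm_cast)
    exact h.comp (0 : ℝ) (f := fun s : ℝ => (s, (0 : ℝ))) (contDiffAt_id.prodMk contDiffAt_const)
  have hG : (fun s => a.G s 0) = fun s => 2 * a.Ψ s 0 := by
    funext s
    simp [G]
  have hd : deriv (fun s => a.G s 0) = fun s => 2 * deriv (fun s => a.Ψ s 0) s := by
    rw [hG]
    funext s
    exact deriv_const_mul_field 2
  have hc : Tendsto (fun s => a.G s 0 / s ^ 3) (𝓝[>] 0) (𝓝 a.h30) := by
    have := (a.tendsto_G_curve 0).comp (tendsto_prodMk_cubicFilter (left_mem_Icc.2 le_rfl))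
    simpa [Function.comp_def] using this
  have key := tendsto_deriv_div_sq_of_tendsto_div_cube hφ (by simp [G, a.Ψ_origin])
    (by simp [hd, a.Ψr_origin])
    (by rw [hd, deriv_const_mul_field, a.Ψrr_origin, mul_zero]) hc
  refine key.congr' ?_
  filter_upwards [self_mem_nhdsWithin, nhdsWithin_le_nhds (eventually_le_nhds a.r₀_pos)]
    with r hr hr'
  rw [(a.hasDerivAt_G ⟨le_of_lt hr, hr'⟩ a.zero_mem_Icc).deriv]

theorem tendsto_Gr_curve (x : ℝ) :
    Tendsto (fun q : ℝ × ℝ => a.Gr (q.1, q.1 ^ 3 * q.2) / q.1 ^ 2) (cubicFilter x)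
      (𝓝 (3 * a.h30)) := by
  obtain ⟨K, s, hs, hK⟩ :=
    (a.contDiffAt_Gr a.zero_mem_Icc a.zero_mem_Icc).exists_lipschitzOnWith
  have haxis : Tendsto (fun q : ℝ × ℝ => (q.1, (0 : ℝ))) (cubicFilter x)
      (𝓝 ((0 : ℝ), (0 : ℝ))) := (tendsto_fst_cubicFilter x).prodMk_nhds tendsto_const_nhds
  have hdiff : Tendsto (fun q : ℝ × ℝ =>
      (a.Gr (q.1, q.1 ^ 3 * q.2) - a.Gr (q.1, 0)) / q.1 ^ 2) (cubicFilter x) (𝓝 0) := by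
    have hb : Tendsto (fun q : ℝ × ℝ => (K : ℝ) * (q.1 ^ 1 * q.2)) (cubicFilter x) (𝓝 0) := by
      simpa using (tendsto_pow_mul_cubicFilter x (k := 1) one_ne_zero).const_mul (K : ℝ)
    refine squeeze_zero_norm' ?_ hb
    filter_upwards [eventually_cubicFilter x, (tendsto_curve x).eventually hs,
      haxis.eventually hs] with q hq h1 h2
    have hr := hq.1
    have ht := hq.2.1
    have h := hK.dist_le_mul _ h1 _ h2
    have hdist : dist (q.1, q.1 ^ 3 * q.2) (q.1, (0 : ℝ)) = q.1 ^ 3 * q.2 := by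
      rw [Prod.dist_eq, dist_self, Real.dist_eq, sub_zero, abs_of_nonneg (by positivity)]
      exact max_eq_right (by positivity)
    rw [hdist, Real.dist_eq] at h
    rw [norm_div, Real.norm_eq_abs, Real.norm_of_nonneg (by positivity), div_le_iff₀ (by positivity)]
    exact h.trans_eq (by ring)
  have hsum := hdiff.add (a.tendsto_Gr_axis.comp tendsto_fst)
  rw [zero_add] at hsum
  refine hsum.congr fun q => ?_
  simp only [Function.comp_apply]
  ring

theorem tendsto_coefficient_curve (x : ℝ) :
    Tendsto (fun q : ℝ × ℝ => -(1 / 2) * (a.Y q.1 (q.1 ^ 3 * q.2))⁻¹ *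
        (a.Gr (q.1, q.1 ^ 3 * q.2) / q.1 ^ 2) /
        (a.G q.1 (q.1 ^ 3 * q.2) / q.1 ^ 3 * √(a.G q.1 (q.1 ^ 3 * q.2) / q.1 ^ 3)))
      (cubicFilter x) (𝓝 (-(3 / 2) / √a.h30)) := by
  have hα := a.α_pos
  have hs := Real.sqrt_pos.2 hα
  have h := ((((a.tendsto_Y_curve x).inv₀ one_ne_zero).const_mul (-(1 / 2))).mul
    (a.tendsto_Gr_curve x)).div ((a.tendsto_G_curve x).mul (a.tendsto_G_curve x).sqrt)
    (by positivity)
  have hL : -(1 / 2) * (1 : ℝ)⁻¹ * (3 * a.h30) / (a.h30 * √a.h30) = -(3 / 2) / √a.h30 := by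
    field_simp
  rw [hL] at h
  exact h

/-- On the curve `σ = r³ t` the rescaled integrand factors as `√t` times a convergent
coefficient. -/
theorem mul_integrand_curve {r t : ℝ} (hr : r ∈ Icc 0 a.r₀) (hpos : 0 < r)
    (hσ : r ^ 3 * t ∈ Icc 0 a.r₀) (hG : 0 < a.G r (r ^ 3 * t)) :
    r * ((a.Y r (r ^ 3 * t))⁻¹ * deriv (fun s => a.H s (r ^ 3 * t)) r) =
      √t * (-(1 / 2) * (a.Y r (r ^ 3 * t))⁻¹ * (a.Gr (r, r ^ 3 * t) / r ^ 2) /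
        (a.G r (r ^ 3 * t) / r ^ 3 * √(a.G r (r ^ 3 * t) / r ^ 3))) := by
  have hY := a.Y_pos r hr _ hσ
  have h1 : 0 < √(r ^ 3) := Real.sqrt_pos.2 (by positivity)
  have h2 : 0 < √(a.G r (r ^ 3 * t)) := Real.sqrt_pos.2 hG
  rw [a.deriv_H hr hσ hG, Real.sqrt_div hG.le, Real.sqrt_mul (by positivity)]
  field_simp

theorem eventually_G_pos :
    ∀ᶠ r in 𝓝[>] (0 : ℝ), 0 < r ∧ r ≤ a.r₀ ∧ ∀ σ ∈ Icc 0 r, 0 < a.G r σ := by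
  have hc := (a.tendsto_G_curve 0).comp (tendsto_prodMk_cubicFilter (left_mem_Icc.2 le_rfl))
  filter_upwards [self_mem_nhdsWithin, nhdsWithin_le_nhds (eventually_le_nhds a.r₀_pos),
    hc.eventually (eventually_gt_nhds a.α_pos)] with r (hr : 0 < r) hr' h
  refine ⟨hr, hr', fun σ hσ => ?_⟩
  rcases hσ.1.eq_or_lt with rfl | hpos
  · simp only [Function.comp_apply, mul_zero] at h
    exact (div_pos_iff_of_pos_right (by positivity)).1 h
  · exact a.G_pos r σ hpos hσ.2 hr'

theorem eventually_cube_le (x : ℝ) : ∀ᶠ r in 𝓝[>] (0 : ℝ), x * r ^ 3 ≤ r := by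
  have h : Tendsto (fun r : ℝ => x * r ^ 2) (𝓝[>] 0) (𝓝 0) := by
    have : Tendsto (fun r : ℝ => x * r ^ 2) (𝓝 0) (𝓝 (x * 0 ^ 2)) :=
      Continuous.tendsto (by fun_prop) 0
    simpa using this.mono_left nhdsWithin_le_nhds
  filter_upwards [self_mem_nhdsWithin, h.eventually (eventually_le_nhds one_pos)]
    with r (hr : 0 < r) h
  nlinarith

/-- The difference quotient of `√Δ` as an integral over the fixed interval `[0,x]`. -/
theorem eventually_sqrtΔ_sub {x : ℝ} (hx : 0 < x) : ∀ᶠ r in 𝓝[>] (0 : ℝ),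
    (a.sqrtΔ r (x * r ^ 3) - a.sqrtΔ r 0) / r ^ 2 =
      -∫ t in (0 : ℝ)..x, r * ((a.Y r (r ^ 3 * t))⁻¹ * deriv (fun s => a.H s (r ^ 3 * t)) r) := by
  filter_upwards [a.eventually_G_pos, eventually_cube_le x] with r ⟨hr, hr', hG⟩ hxr
  have hc := a.continuousOn_integrand ⟨hr.le, hr'⟩ hG
  have hx0 : 0 ≤ x * r ^ 3 := by positivity
  set f := fun σ => (a.Y r σ)⁻¹ * deriv (fun s => a.H s σ) r with hf
  have i1 : IntervalIntegrable f volume 0 (x * r ^ 3) :=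
    (hc.mono (Icc_subset_Icc_right hxr)).intervalIntegrable_of_Icc hx0
  have i2 : IntervalIntegrable f volume (x * r ^ 3) r :=
    (hc.mono (Icc_subset_Icc_left hx0)).intervalIntegrable_of_Icc hxr
  have hadd := intervalIntegral.integral_add_adjacent_intervals i1 i2
  have hsub := intervalIntegral.integral_comp_mul_left (a := 0) (b := x) f
    (c := r ^ 3) (by positivity)
  rw [mul_zero, mul_comm (r ^ 3) x, smul_eq_mul] at hsub
  rw [intervalIntegral.integral_const_mul]
  change _ = -(r * ∫ t in (0 : ℝ)..x, f (r ^ 3 * t))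
  rw [hsub]
  simp only [sqrtΔ]
  change (((∫ σ in (x * r ^ 3)..r, f σ) + _) - ((∫ σ in (0 : ℝ)..r, f σ) + _)) / _ = _
  rw [← hadd]
  field_simp
  ring

theorem tendsto_integral_curve {x : ℝ} (hx : 0 < x) :
    Tendsto (fun r : ℝ => ∫ t in (0 : ℝ)..x,
        r * ((a.Y r (r ^ 3 * t))⁻¹ * deriv (fun s => a.H s (r ^ 3 * t)) r))
      (𝓝[>] 0) (𝓝 (∫ t in (0 : ℝ)..x, √t * (-(3 / 2) / √a.h30))) := by
  have hsub : ∀ t ∈ uIoc 0 x, t ∈ Icc 0 x := fun t ht => by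
    rw [uIoc_of_le hx.le] at ht
    exact ⟨ht.1.le, ht.2⟩
  have hmem : ∀ᶠ r in 𝓝[>] (0 : ℝ), 0 < r ∧ r ∈ Icc 0 a.r₀ ∧ (∀ σ ∈ Icc 0 r, 0 < a.G r σ) ∧
      ∀ t ∈ Icc 0 x, r ^ 3 * t ∈ Icc 0 r := by
    filter_upwards [a.eventually_G_pos, eventually_cube_le x] with r ⟨hr, hr', hG⟩ hxr
    refine ⟨hr, ⟨hr.le, hr'⟩, hG, fun t ht => ⟨mul_nonneg (by positivity) ht.1, ?_⟩⟩
    refine le_trans ?_ hxr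
    rw [mul_comm]
    have := ht.2
    gcongr
  have hfac : ∀ᶠ r in 𝓝[>] (0 : ℝ), ∀ t ∈ Icc 0 x,
      r * ((a.Y r (r ^ 3 * t))⁻¹ * deriv (fun s => a.H s (r ^ 3 * t)) r) =
      √t * (-(1 / 2) * (a.Y r (r ^ 3 * t))⁻¹ * (a.Gr (r, r ^ 3 * t) / r ^ 2) /
        (a.G r (r ^ 3 * t) / r ^ 3 * √(a.G r (r ^ 3 * t) / r ^ 3))) := by
    filter_upwards [hmem] with r ⟨hr, hr', hG, hσ⟩ t ht
    exact a.mul_integrand_curve hr' hr ⟨(hσ t ht).1, (hσ t ht).2.trans hr'.2⟩ (hG _ (hσ t ht))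
  have hcoef := a.tendsto_coefficient_curve x
  set L := -(3 / 2) / √a.h30
  have hbound := eventually_prod_principal_iff.1
    (hcoef.norm.eventually (eventually_le_nhds (lt_add_one ‖L‖)))
  refine intervalIntegral.tendsto_integral_filter_of_dominated_convergence
    (fun t => √t * (‖L‖ + 1)) ?_ ?_ ?_ ?_
  · filter_upwards [hmem] with r ⟨hr, hr', hG, hσ⟩
    refine ContinuousOn.aestronglyMeasurable ?_ measurableSet_uIoc
    exact continuousOn_const.mul ((a.continuousOn_integrand hr' hG).comp
      (continuousOn_const.mul continuousOn_id) fun t ht => hσ t (hsub t ht))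
  · filter_upwards [hfac, hbound] with r h1 h2
    refine Eventually.of_forall fun t ht => ?_
    rw [h1 t (hsub t ht), norm_mul, Real.norm_of_nonneg (Real.sqrt_nonneg t)]
    exact mul_le_mul_of_nonneg_left (h2 t (hsub t ht)) (Real.sqrt_nonneg t)
  · exact Continuous.intervalIntegrable (by fun_prop) _ _
  · refine Eventually.of_forall fun t ht => ?_
    refine ((hcoef.comp (tendsto_prodMk_cubicFilter (hsub t ht))).const_mul (√t)).congr' ?_
    filter_upwards [hfac] with r h1
    exact (h1 t (hsub t ht)).symm

end ARSData

/-- **Asymptotics along cubic curves.** In a collapsing ARS model, for every fixed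
`x > 0`, along the curve `R = x r³` one has `u(r, x r³) → √(α/x)`, `Y(r, x r³) → 1`,
and `(√Δ(r, x r³) − √Δ(r,0))/r² → x^{3/2}/√α` as `r → 0⁺`. -/
theorem asymptotics_along_cubic_curve (a : ARSData) (x : ℝ) (hx : 0 < x) :
    Tendsto (fun r : ℝ => a.u r (x * r ^ 3)) (𝓝[>] 0) (𝓝 (Real.sqrt (a.h30 / x))) ∧
    Tendsto (fun r : ℝ => a.Y r (x * r ^ 3)) (𝓝[>] 0) (𝓝 1) ∧
    Tendsto (fun r : ℝ => (a.sqrtΔ r (x * r ^ 3) - a.sqrtΔ r 0) / r ^ 2)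
      (𝓝[>] 0) (𝓝 (x ^ ((3:ℝ)/2) / Real.sqrt a.h30)) := by
  have hxm : x ∈ Icc 0 x := right_mem_Icc.2 hx.le
  refine ⟨?_, ?_, ?_⟩
  · have h := ((a.tendsto_G_curve x).comp (ARSData.tendsto_prodMk_cubicFilter hxm)).div_const x
    refine h.sqrt.congr fun r => ?_
    simp only [Function.comp_apply, ARSData.u, mul_comm x, div_div]
  · refine ((a.tendsto_Y_curve x).comp (ARSData.tendsto_prodMk_cubicFilter hxm)).congr fun r => ?_
    simp only [Function.comp_apply, mul_comm x]
  · have h := (a.tendsto_integral_curve hx).neg.congr'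
      ((a.eventually_sqrtΔ_sub hx).mono fun _ h => h.symm)
    rw [intervalIntegral.integral_mul_const, integral_sqrt_zero_left] at h
    convert h using 2
    ring
end
end
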